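/- Let S = Spec(R) be the spectrum of a Noetherian strictly henselian local ring with closed point s, f: X → S a semistable morphism, and η a generalisation of s. Let X₁ and X₂ be irreducible components of X_s which intersect and contain a common element Z of the k-strata of X_s for some k ≥ 1, whose label (b) is generated by an element b that becomes a unit over η. Then sp_{s→η}(X₁) = sp_{s→η}(X₂). -/

import Mathlib

/-!
Common infrastructure for formalizing "Néron models of jacobians over base schemes of
dimension greater than 1" (semistable morphisms, strata, dual graphs, alignment,
specialisation maps, Cartier/Weil divisors, Picard data, Néron models).

Notes on design choices (Mathlib has no algebraic spaces, no Picard functor, no strict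
henselisation and no excellent rings):
* Algebraic spaces are replaced by schemes throughout.
* The label of a point of a semistable morphism over a strictly henselian local base is
  taken in the local ring itself (which agrees with the strict henselisation there), and
  alignment over a general base is defined via base change to arbitrary strictly
  henselian Noetherian local test rings (which is equivalent to the definition via
  geometric points, since the strict henselisations are among such test rings).
* Excellence of the base is beyond current Mathlib and is omitted from hypotheses.
-/

open AlgebraicGeometry CategoryTheory CategoryTheory.Limits

universe u

noncomputable section

namespace NeronSemistable

/-! ### Local properties of morphisms of schemes -/

/-- `f` is smooth at the point `x` if it is smooth on an open neighbourhood of `x`. -/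
def SmoothAtPt {X S : Scheme.{u}} (f : X ⟶ S) (x : X) : Prop :=
  ∃ U : X.Opens, x ∈ U ∧ IsSmooth (U.ι ≫ f)

/-- `f` is étale at the point `x` if it is étale on an open neighbourhood of `x`. -/
def EtaleAtPt {X S : Scheme.{u}} (f : X ⟶ S) (x : X) : Prop :=
  ∃ U : X.Opens, x ∈ U ∧ IsEtale (U.ι ≫ f)

/-- `f` is flat at `x` if the induced map of stalks is flat. -/
def FlatAtPt {X S : Scheme.{u}} (f : X ⟶ S) (x : X) : Prop :=
  letI := (f.stalkMap x).hom.toAlgebra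
  Module.Flat (S.presheaf.stalk (f.base x)) (X.presheaf.stalk x)

/-- A morphism of schemes is flat if it is flat at every point. -/
def SchemeFlat {X S : Scheme.{u}} (f : X ⟶ S) : Prop := ∀ x : X, FlatAtPt f x

/-- The non-smooth locus of a morphism, as a set of points. -/
def NonSmoothLocus {X S : Scheme.{u}} (f : X ⟶ S) : Set X := {x | ¬ SmoothAtPt f x}

/-! ### Fibres -/

/-- The scheme-theoretic fibre `X_s` of `f : X ⟶ S` over `s ∈ S`. -/
def fiberScheme {X S : Scheme.{u}} (f : X ⟶ S) (s : S) : Scheme.{u} :=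
  pullback f (S.fromSpecResidueField s)

/-- The projection from the fibre `X_s` to `X`. -/
def fiberι {X S : Scheme.{u}} (f : X ⟶ S) (s : S) : fiberScheme f s ⟶ X :=
  pullback.fst f (S.fromSpecResidueField s)

/-- The structure morphism of the fibre `X_s` to the spectrum of the residue field. -/
def fiberRes {X S : Scheme.{u}} (f : X ⟶ S) (s : S) :
    fiberScheme f s ⟶ Spec (S.residueField s) :=
  pullback.snd f (S.fromSpecResidueField s)

/-- `f : X ⟶ S` has geometrically connected fibres. -/
def GeomConnFibers {X S : Scheme.{u}} (f : X ⟶ S) : Prop :=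
  ∀ (K : Type u) [Field K] [IsAlgClosed K] (g : Spec (CommRingCat.of K) ⟶ S),
    ConnectedSpace ↑(pullback f g)

/-- A subset `T` of a scheme `Z` over (the spectrum of) a field object `k` is geometrically
irreducible if its preimage in `Z ×_k K` is irreducible for every field extension `K` of `k`. -/
def GeomIrreducibleOver (k : CommRingCat.{u}) {Z : Scheme.{u}} (g : Z ⟶ Spec k)
    (T : Set Z) : Prop :=
  ∀ (K : Type u) [Field K] (ψ : k ⟶ CommRingCat.of K),
    IsIrreducible ((pullback.fst g (Spec.map ψ)).base ⁻¹' T)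

/-! ### Standard local models `Spec R[x₁,…,xₙ]/(x₁⋯x_l − b)` and semistable morphisms -/

open MvPolynomial in
/-- The ring `R[x₁,…,xₙ]/(x₁⋯x_l − b)`. -/
abbrev stdRing (R : Type u) [CommRing R] (n l : ℕ) (b : R) : Type u :=
  MvPolynomial (Fin n) R ⧸
    Ideal.span {(∏ i : Fin n, if (i : ℕ) < l then X i else 1) - C b}

/-- The standard local model as a scheme. -/
def stdScheme (R : Type u) [CommRing R] (n l : ℕ) (b : R) : Scheme.{u} :=
  Spec (CommRingCat.of (stdRing R n l b))

/-- The structure morphism of the standard local model. -/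
def stdSpec (R : CommRingCat.{u}) (n l : ℕ) (b : R) : stdScheme ↥R n l b ⟶ Spec R :=
  Spec.map (CommRingCat.ofHom (algebraMap ↥R (stdRing ↥R n l b)))

open MvPolynomial in
/-- The class of the coordinate `x_i` in the standard model. -/
def stdCoord (R : Type u) [CommRing R] (n l : ℕ) (b : R) (i : Fin n) : stdRing R n l b :=
  Ideal.Quotient.mk _ (X i)

/-- The data of a commutative diagram exhibiting `f` étale-locally at `x` as a standard
semistable model `Spec R[x₁,…,xₙ]/(x₁⋯x_l − b)`, as in the definition of a semistable
morphism. -/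
structure ChartData {X S : Scheme.{u}} (f : X ⟶ S) (x : X) where
  R : CommRingCat.{u}
  n : ℕ
  l : ℕ
  hln : l ≤ n
  b : ↥R
  etS : Spec R ⟶ S
  etS_etale : IsEtale etS
  s' : ↑(Spec R)
  hs' : etS.base s' = f.base x
  U : Scheme.{u}
  U_conn : ConnectedSpace ↑U
  gX : U ⟶ X
  gX_etale : IsEtale gX
  x' : ↑U
  hx' : gX.base x' = x
  gT : U ⟶ stdScheme ↥R n l b
  gT_etale : IsEtale gT
  comm : gT ≫ stdSpec R n l b ≫ etS = gX ≫ f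

/-- A morphism is semistable if it is proper with geometrically connected fibres and admits
standard semistable charts étale-locally at every point. -/
def IsSemistable {X S : Scheme.{u}} (f : X ⟶ S) : Prop :=
  IsProper f ∧ GeomConnFibers f ∧ ∀ x : X, Nonempty (ChartData f x)

/-! ### Local rings: regularity, strict henselianity -/

/-- The closed point of `Spec R` for a local ring `R` (with the local-ring witness passed
explicitly). -/
def closedPt (R : CommRingCat.{u}) (h : IsLocalRing ↥R) : ↑(Spec R) :=
  (@IsLocalRing.closedPoint ↥R _ h : PrimeSpectrum ↥R)

/-- A commutative ring is strictly henselian local if it is a henselian local ring with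
separably closed residue field. -/
structure StrictlyHenselianLocal (A : Type u) [CommRing A] : Prop where
  toIsLocalRing : IsLocalRing A
  henselian : HenselianLocalRing A
  sepClosedResidue : @IsSepClosed (@IsLocalRing.ResidueField A _ toIsLocalRing)
      (@IsLocalRing.ResidueField.field A _ toIsLocalRing)

/-- A Noetherian local ring is regular if its maximal ideal is generated by
`dim R` many elements. -/
def IsRegularLocal (A : Type u) [CommRing A] : Prop :=
  IsNoetherianRing A ∧ ∃ (h : IsLocalRing A) (s : Finset A),
    Ideal.span (s : Set A) = @IsLocalRing.maximalIdeal A _ h ∧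
    (s.card : WithBot (WithTop ℕ)) = ringKrullDim A

/-- A scheme is regular if all its local rings are regular (and it is locally Noetherian). -/
def IsRegularScheme (X : Scheme.{u}) : Prop :=
  IsLocallyNoetherian X ∧ ∀ x : X, IsRegularLocal ↥(X.presheaf.stalk x)

/-! ### Labels of points of semistable morphisms over a local base -/

/-- Over an affine base `Spec R`, the point `x` (of the non-smooth locus of its fibre) has
label `(b)`, `b ∈ R`, if there is a local chart
`U ⟶ Spec R[x₁,…,xₙ]/(x₁⋯x_l − b)` at `x` (with the coordinates `x₁,…,x_l` contained in
the prime ideal of the image of `x`).  Over a strictly henselian local ring this agrees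
with the usual label in the strict henselisation. -/
def HasLabel {R : CommRingCat.{u}} {X : Scheme.{u}} (f : X ⟶ Spec R) (x : X) (b : ↥R) :
    Prop :=
  ∃ (n l : ℕ), l ≤ n ∧
    ∃ (U : Scheme.{u}) (gX : U ⟶ X) (x' : ↑U) (gT : U ⟶ stdScheme ↥R n l b),
      IsEtale gX ∧ IsEtale gT ∧ gX.base x' = x ∧
      gT ≫ stdSpec R n l b = gX ≫ f ∧
      ∀ i : Fin n, (i : ℕ) < l → stdCoord ↥R n l b i ∈ (gT.base x').asIdeal

/-! ### Reduced closed subschemes and strata of fibres -/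

/-- A realisation of the closed subset `C ⊆ X` as a reduced closed subscheme of `X`
(such a realisation always exists and is unique up to unique isomorphism). -/
structure ReducedClosedSubscheme (X : Scheme.{u}) (C : Set X) where
  Z : Scheme.{u}
  ι : Z ⟶ X
  isClosedImmersion : IsClosedImmersion ι
  reduced : IsReduced Z
  range : Set.range ι.base = C

/-- `Sing` is the sequence of iterated non-smooth loci of a scheme `Z` over a field object
`k`: `Sing 0 = Z`, and `Sing (r+1)` is the non-smooth locus over `k` of `Sing r` endowed
with its reduced induced closed subscheme structure. -/
def IsSingSeq {k : CommRingCat.{u}} {Z : Scheme.{u}} (g : Z ⟶ Spec k)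
    (Sing : ℕ → Set Z) : Prop :=
  Sing 0 = Set.univ ∧
  ∀ r : ℕ, ∃ W : ReducedClosedSubscheme Z (Sing r),
    Sing (r + 1) = W.ι.base '' {z | ¬ SmoothAtPt (W.ι ≫ g) z}

/-- `T` is an `r`-stratum of the scheme `Z` over the field object `k`: an irreducible
component of the smooth locus of the `r`-th iterated non-smooth locus of `Z` over `k`. -/
def IsStratum {k : CommRingCat.{u}} {Z : Scheme.{u}} (g : Z ⟶ Spec k) (r : ℕ)
    (T : Set Z) : Prop :=
  ∃ Sing : ℕ → Set Z, IsSingSeq g Sing ∧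
    ∃ W : ReducedClosedSubscheme Z (Sing r),
      ∃ T' ∈ irreducibleComponents {z : W.Z // SmoothAtPt (W.ι ≫ g) z},
        T = W.ι.base '' (Subtype.val '' T')

/-! ### Dual graphs, cycles and alignment over a local base -/

/-- The (1-)stratum `T` of the closed fibre of `f` has label `b` (i.e. some — equivalently,
by constancy of labels, any — point of it has label `b`). -/
def StratumHasLabel {R : CommRingCat.{u}} {X : Scheme.{u}} (f : X ⟶ Spec R)
    (s : ↑(Spec R)) (T : Set (fiberScheme f s)) (b : ↥R) : Prop :=
  ∃ z ∈ T, HasLabel f ((fiberι f s).base z) b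

/-- A cycle in the dual graph of the fibre of `f : X ⟶ Spec R` over the point `s`:
a cyclic sequence of pairwise distinct vertices (irreducible components of the fibre)
joined by pairwise distinct edges (1-strata, each contained in exactly the two
neighbouring components). -/
structure GraphCycle {R : CommRingCat.{u}} {X : Scheme.{u}} (f : X ⟶ Spec R)
    (s : ↑(Spec R)) where
  N : ℕ
  hN : 0 < N
  v : Fin N → Set (fiberScheme f s)
  hv : ∀ i, v i ∈ irreducibleComponents ↑(fiberScheme f s)
  v_inj : Function.Injective v
  T : Fin N → Set (fiberScheme f s)
  hT : ∀ i, IsStratum (fiberRes f s) 1 (T i)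
  T_inj : Function.Injective T
  incident : ∀ i : Fin N,
    {c ∈ irreducibleComponents ↑(fiberScheme f s) | T i ⊆ c} =
      {v i, v (⟨((i : ℕ) + 1) % N, Nat.mod_lt _ hN⟩ : Fin N)}

/-- `f : X ⟶ Spec R` (for `R` local) is aligned at the closed point: for any cycle in the
dual graph of the closed fibre, the labels of any two of its edges admit equal positive
powers (as ideals of `R`). -/
def AlignedOver {R : CommRingCat.{u}} (hR : IsLocalRing ↥R) {X : Scheme.{u}}
    (f : X ⟶ Spec R) : Prop :=
  ∀ (c : GraphCycle f (closedPt R hR)) (i j : Fin c.N) (bi bj : ↥R),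
    StratumHasLabel f (closedPt R hR) (c.T i) bi →
    StratumHasLabel f (closedPt R hR) (c.T j) bj →
    ∃ n m : ℕ, 0 < n ∧ 0 < m ∧ Ideal.span {bi} ^ n = Ideal.span {bj} ^ m

/-- `f : X ⟶ S` is aligned (at every geometric point): the base change of `f` to any
Noetherian strictly henselian local test ring over `S` is aligned at the closed point.
(Taking the test ring to be a strict henselisation of a local ring of `S` recovers the
notion of alignment at a geometric point of `S`.) -/
def IsAligned {X S : Scheme.{u}} (f : X ⟶ S) : Prop :=
  ∀ (A : CommRingCat.{u}), IsNoetherianRing ↥A →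
    ∀ (h : StrictlyHenselianLocal ↥A) (g : Spec A ⟶ S),
      AlignedOver h.toIsLocalRing (pullback.snd f g)

/-! ### The specialisation relation on irreducible components of fibres -/

/-- The irreducible component `Z` of the fibre `X_s` specialises (under `sp_{s→η}`) to the
irreducible component `Y` of `X_η`, i.e. `Z` is contained in the fibre over `s` of the
closure of `Y` in `X`. -/
def spRel {X S : Scheme.{u}} (f : X ⟶ S) (s η : S)
    (Z : Set (fiberScheme f s)) (Y : Set (fiberScheme f η)) : Prop :=
  (fiberι f s).base '' Z ⊆ closure ((fiberι f η).base '' Y)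

/-- `C` is a connected component of the subset `A` of a topological space. -/
def IsConnCompOf {α : Type u} [TopologicalSpace α] (A C : Set α) : Prop :=
  ∃ x : ↥A, C = Subtype.val '' connectedComponent x
/-! ### Orders of vanishing, Weil divisors and Cartier divisors -/

/-- `a` has order (length of `A/(a)` as an `A`-module, computed as the Krull dimension of
the lattice of submodules) equal to `m`. -/
def elemOrd (A : Type u) [CommRing A] (a : A) (m : ℕ) : Prop :=
  Order.krullDim (Submodule A (A ⧸ Ideal.span {a})) = (m : ℕ∞)

/-- The order of vanishing of `a ∈ R` at the point `p` of `Spec R` is `k`. -/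
def IsLocOrd {R : Type u} [CommRing R] (a : R) (p : PrimeSpectrum R) (k : ℕ) : Prop :=
  elemOrd (Localization (@Ideal.primeCompl R _ p.asIdeal p.2))
    (algebraMap R (Localization (@Ideal.primeCompl R _ p.asIdeal p.2)) a) k

/-- `z` is a divisorial point of `X`: its local ring has Krull dimension 1, i.e. the
closure of `z` is a prime divisor on `X`. -/
def IsDivisorialPt (X : Scheme.{u}) (z : X) : Prop :=
  ringKrullDim ↥(X.presheaf.stalk z) = 1

/-- The order of vanishing at `z ∈ V` of the section `h ∈ Γ(X, V)` is `m`. -/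
def germOrd {X : Scheme.{u}} (V : X.Opens) (h : Γ(X, V)) (z : X) (hz : z ∈ V)
    (m : ℕ) : Prop :=
  elemOrd ↥(X.presheaf.stalk z) (X.presheaf.germ V z hz h) m

/-- A Weil divisor on `X` is recorded as a coefficient function on points of `X`; only its
values at divisorial points are relevant. `CutsOn D V h₁ h₂` says that on the open set `V`
the divisor `D` is cut out by the pair of nonzerodivisors `(h₁, h₂)` (i.e. `D` equals
`div h₁ − div h₂` on `V`). -/
def CutsOn {X : Scheme.{u}} (D : X → ℤ) (V : X.Opens) (h₁ h₂ : Γ(X, V)) : Prop :=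
  h₁ ∈ nonZeroDivisors Γ(X, V) ∧ h₂ ∈ nonZeroDivisors Γ(X, V) ∧
  ∀ z (hz : z ∈ V), IsDivisorialPt X z →
    ∀ m₁ m₂ : ℕ, germOrd V h₁ z hz m₁ → germOrd V h₂ z hz m₂ →
      D z = (m₁ : ℤ) - (m₂ : ℤ)

/-- The Weil divisor `D` is a Cartier divisor: it is cut out locally by ratios of
nonzerodivisor sections. -/
def IsCartierDiv {X : Scheme.{u}} (D : X → ℤ) : Prop :=
  ∀ x : X, ∃ V : X.Opens, x ∈ V ∧ ∃ h₁ h₂ : Γ(X, V), CutsOn D V h₁ h₂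

/-- `D'` is the pullback along `p : W ⟶ X` of the Cartier divisor `D` on `X`: at every
divisorial point of `W`, the coefficient of `D'` is computed by pulling back local
equations of `D`. -/
def IsDivPullback {W X : Scheme.{u}} (p : W ⟶ X) (D : X → ℤ) (D' : W → ℤ) : Prop :=
  ∀ w : W, IsDivisorialPt W w →
    ∀ (V : X.Opens) (hw : p.base w ∈ V) (h₁ h₂ : Γ(X, V)), CutsOn D V h₁ h₂ →
      ∀ m₁ m₂ : ℕ, germOrd (p ⁻¹ᵁ V) (p.app V h₁) w hw m₁ →
        germOrd (p ⁻¹ᵁ V) (p.app V h₂) w hw m₂ →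
          D' w = (m₁ : ℤ) - (m₂ : ℤ)

/-- Two Weil divisors on `X` are linearly equivalent if their difference is the divisor of
a global ratio of nonzerodivisor sections. -/
def LinEquivDiv {X : Scheme.{u}} (D D' : X → ℤ) : Prop :=
  ∃ h₁ h₂ : Γ(X, ⊤), h₁ ∈ nonZeroDivisors Γ(X, ⊤) ∧ h₂ ∈ nonZeroDivisors Γ(X, ⊤) ∧
    ∀ z : X, IsDivisorialPt X z →
      ∀ m₁ m₂ : ℕ, germOrd ⊤ h₁ z trivial m₁ → germOrd ⊤ h₂ z trivial m₂ →
        D z - D' z = (m₁ : ℤ) - (m₂ : ℤ)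

/-! ### Group schemes over a base (group objects via generalized points) -/

/-- A group scheme over `S`: a scheme `G/S` together with multiplication, unit and
inverse morphisms satisfying the group axioms (expressed on generalized points). -/
structure GroupSchemeOver (S : Scheme.{u}) where
  G : Scheme.{u}
  π : G ⟶ S
  e : S ⟶ G
  e_sec : e ≫ π = 𝟙 S
  mul : pullback π π ⟶ G
  mul_over : mul ≫ π = pullback.fst π π ≫ π
  inv : G ⟶ G
  inv_over : inv ≫ π = π
  mul_assoc' : ∀ {T : Scheme.{u}} (a b c : T ⟶ G) (hab : a ≫ π = b ≫ π)
    (hbc : b ≫ π = c ≫ π)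
    (h₁ : (pullback.lift a b hab ≫ mul) ≫ π = c ≫ π)
    (h₂ : a ≫ π = (pullback.lift b c hbc ≫ mul) ≫ π),
    pullback.lift (pullback.lift a b hab ≫ mul) c h₁ ≫ mul =
      pullback.lift a (pullback.lift b c hbc ≫ mul) h₂ ≫ mul
  one_mul' : ∀ {T : Scheme.{u}} (a : T ⟶ G) (h : (a ≫ π ≫ e) ≫ π = a ≫ π),
    pullback.lift (a ≫ π ≫ e) a h ≫ mul = a
  mul_one' : ∀ {T : Scheme.{u}} (a : T ⟶ G) (h : a ≫ π = (a ≫ π ≫ e) ≫ π),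
    pullback.lift a (a ≫ π ≫ e) h ≫ mul = a
  inv_mul' : ∀ {T : Scheme.{u}} (a : T ⟶ G) (h : (a ≫ inv) ≫ π = a ≫ π),
    pullback.lift (a ≫ inv) a h ≫ mul = a ≫ π ≫ e
/-! ### Line bundles via Čech gluing data, and the relative Picard scheme -/

/-- A line bundle on a scheme `Y`, presented by Čech gluing data: an open cover together
with unit transition functions satisfying the cocycle condition. -/
structure GluingData (Y : Scheme.{u}) where
  I : Type u
  U : I → Y.Opens
  covers : iSup U = ⊤
  t : ∀ i j : I, Γ(Y, U i ⊓ U j)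
  t_isUnit : ∀ i j, IsUnit (t i j)
  cocycle : ∀ i j k : I,
    (Y.presheaf.map (homOfLE (inf_le_left : (U i ⊓ U j) ⊓ U k ≤ U i ⊓ U j)).op) (t i j) *
    (Y.presheaf.map (homOfLE (le_inf (inf_le_left.trans inf_le_right)
      (inf_le_right : (U i ⊓ U j) ⊓ U k ≤ U k))).op) (t j k) =
    (Y.presheaf.map (homOfLE (le_inf (inf_le_left.trans inf_le_left)
      (inf_le_right : (U i ⊓ U j) ⊓ U k ≤ U k))).op) (t i k)

/-- The trivial line bundle. -/
def trivialGluing (Y : Scheme.{u}) : GluingData Y where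
  I := PUnit
  U := fun _ => ⊤
  covers := by simp
  t := fun _ _ => 1
  t_isUnit := fun _ _ => isUnit_one
  cocycle := by intro i j k; simp

/-- `D'` is the pullback of the gluing data `D` along `φ : Z ⟶ Y`. -/
def IsPullbackGluing {Z Y : Scheme.{u}} (φ : Z ⟶ Y) (D : GluingData Y)
    (D' : GluingData Z) : Prop :=
  ∃ eqv : D.I ≃ D'.I,
    (∀ i, D'.U (eqv i) = φ ⁻¹ᵁ D.U i) ∧
    ∀ (i j : D.I) (hle : D'.U (eqv i) ⊓ D'.U (eqv j) ≤ φ ⁻¹ᵁ (D.U i ⊓ D.U j)),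
      D'.t (eqv i) (eqv j) =
        (Z.presheaf.map (homOfLE hle).op) ((φ.app (D.U i ⊓ D.U j)) (D.t i j))

/-- Two gluing data on `Y` present isomorphic line bundles: on a common refinement their
transition functions differ by a coboundary. -/
def GluingIso {Y : Scheme.{u}} (D₁ D₂ : GluingData Y) : Prop :=
  ∃ (K : Type u) (W : K → Y.Opens) (_ : iSup W = ⊤)
    (r₁ : K → D₁.I) (r₂ : K → D₂.I)
    (_ : ∀ k, W k ≤ D₁.U (r₁ k)) (_ : ∀ k, W k ≤ D₂.U (r₂ k))
    (s : ∀ k, Γ(Y, W k)),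
    (∀ k, IsUnit (s k)) ∧
    ∀ (k k' : K) (hle₁ : W k ⊓ W k' ≤ D₁.U (r₁ k) ⊓ D₁.U (r₁ k'))
      (hle₂ : W k ⊓ W k' ≤ D₂.U (r₂ k) ⊓ D₂.U (r₂ k')),
      (Y.presheaf.map (homOfLE hle₁).op) (D₁.t (r₁ k) (r₁ k')) *
        (Y.presheaf.map (homOfLE (inf_le_right : W k ⊓ W k' ≤ W k')).op) (s k') =
      (Y.presheaf.map (homOfLE (inf_le_left : W k ⊓ W k' ≤ W k)).op) (s k) *
        (Y.presheaf.map (homOfLE hle₂).op) (D₂.t (r₂ k) (r₂ k'))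

/-- `D₃` is (isomorphic to) the tensor product of the line bundles presented by `D₁` and
`D₂`: on a common refinement, its transition functions are the products of those of `D₁`
and `D₂`, up to a coboundary. -/
def TensorIso {Y : Scheme.{u}} (D₁ D₂ D₃ : GluingData Y) : Prop :=
  ∃ (K : Type u) (W : K → Y.Opens) (_ : iSup W = ⊤)
    (r₁ : K → D₁.I) (r₂ : K → D₂.I) (r₃ : K → D₃.I)
    (_ : ∀ k, W k ≤ D₁.U (r₁ k)) (_ : ∀ k, W k ≤ D₂.U (r₂ k))
    (_ : ∀ k, W k ≤ D₃.U (r₃ k)) (s : ∀ k, Γ(Y, W k)),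
    (∀ k, IsUnit (s k)) ∧
    ∀ (k k' : K) (hle₁ : W k ⊓ W k' ≤ D₁.U (r₁ k) ⊓ D₁.U (r₁ k'))
      (hle₂ : W k ⊓ W k' ≤ D₂.U (r₂ k) ⊓ D₂.U (r₂ k'))
      (hle₃ : W k ⊓ W k' ≤ D₃.U (r₃ k) ⊓ D₃.U (r₃ k')),
      (Y.presheaf.map (homOfLE hle₃).op) (D₃.t (r₃ k) (r₃ k')) *
        (Y.presheaf.map (homOfLE (inf_le_right : W k ⊓ W k' ≤ W k')).op) (s k') =
      (Y.presheaf.map (homOfLE (inf_le_left : W k ⊓ W k' ≤ W k)).op) (s k) *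
        ((Y.presheaf.map (homOfLE hle₁).op) (D₁.t (r₁ k) (r₁ k')) *
          (Y.presheaf.map (homOfLE hle₂).op) (D₂.t (r₂ k) (r₂ k')))

/-- An fppf cover: faithfully flat and locally of finite presentation. -/
def IsFppfCover {T' T : Scheme.{u}} (c : T' ⟶ T) : Prop :=
  SchemeFlat c ∧ LocallyOfFinitePresentation c ∧ Function.Surjective c.base

/-- For `g : T ⟶ S` and `c : T' ⟶ T`, the induced morphism `X ×_S T' ⟶ X ×_S T`. -/
def inducedMap {X S T T' : Scheme.{u}} (f : X ⟶ S) (g : T ⟶ S) (c : T' ⟶ T) :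
    pullback f (c ≫ g) ⟶ pullback f g :=
  pullback.map f (c ≫ g) f g (𝟙 X) c (𝟙 S) (by simp) (by simp)

/-- Data exhibiting a group scheme `P/S` as (a scheme representing) the relative Picard
functor `Pic_{X/S}`, i.e. the fppf sheafification of `T ↦ Pic(X ×_S T)`:
a natural assignment `toPic` from line bundles on `X ×_S T` to `T`-points of `P`, which is
compatible with pullback, isomorphism and tensor products, sends the trivial bundle to the
unit section, and is fppf-locally bijective. -/
structure PicardData {X S : Scheme.{u}} (f : X ⟶ S) extends GroupSchemeOver S where
  lfp : LocallyOfFinitePresentation π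
  toPic : ∀ {T : Scheme.{u}} (g : T ⟶ S), GluingData (pullback f g) → (T ⟶ G)
  toPic_over : ∀ {T : Scheme.{u}} (g : T ⟶ S) (D : GluingData (pullback f g)),
    toPic g D ≫ π = g
  toPic_trivial : ∀ {T : Scheme.{u}} (g : T ⟶ S),
    toPic g (trivialGluing _) = g ≫ e
  toPic_pullback : ∀ {T T' : Scheme.{u}} (g : T ⟶ S) (c : T' ⟶ T)
    (D : GluingData (pullback f g)) (D' : GluingData (pullback f (c ≫ g))),
    IsPullbackGluing (inducedMap f g c) D D' → toPic (c ≫ g) D' = c ≫ toPic g D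
  toPic_iso : ∀ {T : Scheme.{u}} (g : T ⟶ S) (D₁ D₂ : GluingData (pullback f g)),
    GluingIso D₁ D₂ → toPic g D₁ = toPic g D₂
  toPic_mul : ∀ {T : Scheme.{u}} (g : T ⟶ S) (D₁ D₂ D₃ : GluingData (pullback f g))
    (_ : TensorIso D₁ D₂ D₃)
    (h : toPic g D₁ ≫ π = toPic g D₂ ≫ π),
    pullback.lift (toPic g D₁) (toPic g D₂) h ≫ mul = toPic g D₃
  locally_surjective : ∀ {T : Scheme.{u}} (g : T ⟶ S) (h : T ⟶ G), h ≫ π = g →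
    ∃ (T' : Scheme.{u}) (c : T' ⟶ T), IsFppfCover c ∧
      ∃ D' : GluingData (pullback f (c ≫ g)), toPic (c ≫ g) D' = c ≫ h
  locally_injective : ∀ {T : Scheme.{u}} (g : T ⟶ S)
    (D₁ D₂ : GluingData (pullback f g)), toPic g D₁ = toPic g D₂ →
    ∃ (T' : Scheme.{u}) (c : T' ⟶ T), IsFppfCover c ∧
      ∃ (D₁' D₂' : GluingData (pullback f (c ≫ g))) (E : GluingData T')
        (E' E₂ : GluingData (pullback f (c ≫ g))),
        IsPullbackGluing (inducedMap f g c) D₁ D₁' ∧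
        IsPullbackGluing (inducedMap f g c) D₂ D₂' ∧
        IsPullbackGluing (pullback.snd f (c ≫ g)) E E' ∧
        TensorIso D₁' E' E₂ ∧ GluingIso E₂ D₂'

/-! ### `Pic⁰`, scheme-theoretic closures and Néron models -/

/-- The fibrewise identity component of a group scheme `P/S` over the open set `U ⊆ S`:
the set of points lying over `U` and belonging to the connected component of the unit
section inside their fibre. -/
def pic0Set {S : Scheme.{u}} (P : GroupSchemeOver S) (U : S.Opens) : Set P.G :=
  {p | P.π.base p ∈ U ∧
    p ∈ connectedComponentIn (P.π.base ⁻¹' {P.π.base p}) (P.e.base (P.π.base p))}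

/-- `(Z, ι)` is the scheme-theoretic closure (scheme-theoretic image) of `g : A ⟶ P`:
the smallest closed subscheme of `P` through which `g` factors. -/
structure IsSchClosure {A P : Scheme.{u}} (g : A ⟶ P) (Z : Scheme.{u}) (ι : Z ⟶ P) :
    Prop where
  isClosedImmersion : IsClosedImmersion ι
  factors : ∃ g' : A ⟶ Z, g' ≫ ι = g
  smallest : ∀ (W : Scheme.{u}) (κ : W ⟶ P), IsClosedImmersion κ →
    (∃ w : A ⟶ W, w ≫ κ = g) → ∃ ρ : Z ⟶ W, ρ ≫ κ = ι

/-- A Néron model over `S` of a smooth "abelian" scheme `A` over the dense open `U ⊆ S`: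
a smooth separated scheme `N/S` with an isomorphism `N ×_S U ≅ A` over `U`, satisfying
the Néron mapping property.  (The paper allows `N` to be an algebraic space; algebraic
spaces are not available in Mathlib, so schemes are used.) -/
structure NeronModelData {S : Scheme.{u}} (U : S.Opens) {A : Scheme.{u}}
    (aU : A ⟶ U.toScheme) where
  N : Scheme.{u}
  ν : N ⟶ S
  smooth : IsSmooth ν
  separated : IsSeparated ν
  isoU : (ν ⁻¹ᵁ U).toScheme ≅ A
  isoU_over : isoU.hom ≫ aU = ν ∣_ U
  mapping : ∀ (T : Scheme.{u}) (t : T ⟶ S), IsSmooth t →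
    ∀ (φU : (t ⁻¹ᵁ U).toScheme ⟶ A), φU ≫ aU = t ∣_ U →
      ∃! φ : T ⟶ N, φ ≫ ν = t ∧
        (t ⁻¹ᵁ U).ι ≫ φ = φU ≫ isoU.inv ≫ (ν ⁻¹ᵁ U).ι

/-! ### Projective morphisms -/

attribute [local instance] MvPolynomial.gradedAlgebra

/-- Projective `n`-space (over `Spec (ULift ℤ)`). -/
def projSpace (n : ℕ) : Scheme.{u} :=
  Proj (MvPolynomial.homogeneousSubmodule (Fin (n + 1)) (ULift.{u} ℤ))

/-- Relative projective `n`-space over `S`. -/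
def projSpaceOver (S : Scheme.{u}) (n : ℕ) : Scheme.{u} :=
  pullback (terminal.from (projSpace.{u} n)) (terminal.from S)

/-- A morphism is projective if it factors as a closed immersion into some relative
projective space over the base. -/
def IsProjectiveMorphism {X S : Scheme.{u}} (f : X ⟶ S) : Prop :=
  ∃ (n : ℕ) (ι : X ⟶ projSpaceOver S n),
    IsClosedImmersion ι ∧ ι ≫ pullback.snd _ _ = f
end NeronSemistable
end

noncomputable section
namespace NeronSemistable

section helpersA
open MvPolynomial

theorem isIntegrallyClosed_of_tower {A B : Type*} [CommRing A] [IsDomain A] [CommRing B] [IsDomain B]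
    [IsIntegrallyClosed B] [Algebra A B] (hinj : Function.Injective (algebraMap A B))
    (h : ∀ x : B, IsIntegral A x → ∃ y, algebraMap A B y = x) : IsIntegrallyClosed A := by
  rw [isIntegrallyClosed_iff (FractionRing A)]
  intro x hx
  have hc : Function.Injective ((algebraMap B (FractionRing B)).comp (algebraMap A B)) :=
    (IsFractionRing.injective B (FractionRing B)).comp hinj
  let φ : FractionRing A →+* FractionRing B := IsFractionRing.lift hc
  have hφ : ∀ a, φ (algebraMap A _ a) = algebraMap B (FractionRing B) (algebraMap A B a) := fun a => by
    simp [φ]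
  have h1 : IsIntegral B (φ x) := by
    obtain ⟨p, hp, hpx⟩ := hx
    refine ⟨p.map (algebraMap A B), hp.map _, ?_⟩
    rw [Polynomial.eval₂_map]
    have : (algebraMap B (FractionRing B)).comp (algebraMap A B) = φ.comp (algebraMap A _) := by
      ext a; simp [hφ]
    rw [this, ← Polynomial.hom_eval₂, hpx, map_zero]
  obtain ⟨y, hy⟩ := IsIntegrallyClosed.algebraMap_eq_of_integral h1
  have h2 : IsIntegral A y := by
    obtain ⟨p, hp, hpx⟩ := hx
    refine ⟨p, hp, ?_⟩
    apply IsFractionRing.injective B (FractionRing B)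
    rw [Polynomial.hom_eval₂, hy]
    have : (algebraMap B (FractionRing B)).comp (algebraMap A B) = φ.comp (algebraMap A _) := by
      ext a; simp [hφ]
    rw [this, ← Polynomial.hom_eval₂, hpx, map_zero, map_zero]
  obtain ⟨z, rfl⟩ := h y h2
  refine ⟨z, φ.injective ?_⟩
  rw [hφ, hy]

theorem mvPoly_isIntegrallyClosed {R : Type*} [CommRing R] [IsDomain R] [IsIntegrallyClosed R]
    (σ : Type*) : IsIntegrallyClosed (MvPolynomial σ R) := by
  let K := FractionRing R
  let _ : Algebra (MvPolynomial σ R) (MvPolynomial σ K) := MvPolynomial.algebraMvPolynomial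
  have hinj : Function.Injective (algebraMap (MvPolynomial σ R) (MvPolynomial σ K)) :=
    MvPolynomial.map_injective _ (IsFractionRing.injective R K)
  refine isIntegrallyClosed_of_tower (B := MvPolynomial σ K) hinj fun x hx => ?_
  rw [MvPolynomial.isIntegral_iff_isIntegral_coeff] at hx
  change x ∈ RingHom.range (MvPolynomial.map (algebraMap R K))
  refine MvPolynomial.mem_range_map_iff_coeffs_subset.mpr ?_
  intro c hc
  obtain ⟨n, -, rfl⟩ := MvPolynomial.mem_coeffs_iff.mp hc
  exact IsIntegrallyClosed.algebraMap_eq_of_integral (hx n)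

section std
variable {R : Type*} [CommRing R] [IsDomain R] {σ : Type*} (J : Finset σ) (b : R)

theorem X_dvd_prod_mul_iff {i : σ} (hi : i ∈ J) {b : R} (hb : b ≠ 0) (h : MvPolynomial σ R)
    (hd : X i ∣ ((∏ j ∈ J, X j) - C b) * h) : X i ∣ h := by
  have h1 : (X i : MvPolynomial σ R) ∣ (∏ j ∈ J, X j) := Finset.dvd_prod_of_mem _ hi
  rcases X_prime.dvd_or_dvd hd with h2 | h2
  · exfalso
    have h3 : (X i : MvPolynomial σ R) ∣ C b := by
      have := dvd_sub h1 h2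
      simpa using this
    obtain ⟨c, hc⟩ := h3
    have := congrArg (constantCoeff) hc
    simp at this
    exact hb this
  · exact h2

/-- ring `R[x]/(∏_J x - b)` -/
abbrev GenStd : Type _ := MvPolynomial σ R ⧸ Ideal.span {(∏ j ∈ J, X j : MvPolynomial σ R) - C b}

variable {J b}
/-- coordinate -/
noncomputable def gx (J : Finset σ) (b : R) (i : σ) : GenStd J b := Ideal.Quotient.mk _ (X i)

theorem gx_nzd (hb : b ≠ 0) {i : σ} (hi : i ∈ J) (a : GenStd J b) (h : gx J b i * a = 0) : a = 0 := by
  obtain ⟨a, rfl⟩ := Ideal.Quotient.mk_surjective a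
  rw [gx, ← map_mul, Ideal.Quotient.eq_zero_iff_mem, Ideal.mem_span_singleton] at h
  rw [Ideal.Quotient.eq_zero_iff_mem, Ideal.mem_span_singleton]
  obtain ⟨c, hc⟩ := h
  obtain ⟨d, rfl⟩ := X_dvd_prod_mul_iff J hi hb c ⟨a, hc.symm⟩
  refine ⟨d, ?_⟩
  apply mul_left_cancel₀ (X_ne_zero (R := R) i)
  rw [hc]; ring

theorem gx_dvd (hb : b ≠ 0) {i j : σ} (hi : i ∈ J) (hj : j ∈ J) (hij : i ≠ j) (a : GenStd J b)
    (h : gx J b i ∣ gx J b j * a) : gx J b i ∣ a := by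
  classical
  obtain ⟨a, rfl⟩ := Ideal.Quotient.mk_surjective a
  obtain ⟨c, hc⟩ := h
  obtain ⟨c, rfl⟩ := Ideal.Quotient.mk_surjective c
  rw [gx, gx, ← map_mul, ← map_mul, Ideal.Quotient.eq, Ideal.mem_span_singleton] at hc
  obtain ⟨h, hh⟩ := hc
  -- C b * h ∈ (X i, X j)
  have key : h ∈ Ideal.span (X '' ({i, j} : Set σ) : Set (MvPolynomial σ R)) := by
    have h0 : C b * h ∈ Ideal.span (X '' ({i, j} : Set σ) : Set (MvPolynomial σ R)) := by
      have hXi : (X i : MvPolynomial σ R) ∈ Ideal.span (X '' ({i, j} : Set σ)) :=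
        Ideal.subset_span ⟨i, by simp, rfl⟩
      have hXj : (X j : MvPolynomial σ R) ∈ Ideal.span (X '' ({i, j} : Set σ)) :=
        Ideal.subset_span ⟨j, by simp, rfl⟩
      have e : C b * h = X i * ((∏ k ∈ J.erase i, X k) * h + c) - X j * a := by
        have : (∏ k ∈ J, X k : MvPolynomial σ R) = X i * ∏ k ∈ J.erase i, X k :=
          (Finset.mul_prod_erase J _ hi).symm
        rw [this] at hh
        linear_combination hh
      rw [e]
      exact sub_mem (Ideal.mul_mem_right _ _ hXi) (Ideal.mul_mem_right _ _ hXj)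
    rw [mem_ideal_span_X_image] at h0 ⊢
    intro m hm
    apply h0
    rw [mem_support_iff] at hm ⊢
    rw [coeff_C_mul]
    exact mul_ne_zero hb hm
  rw [Set.image_pair, Ideal.mem_span_pair] at key
  obtain ⟨u, v, rfl⟩ := key
  -- X j (a - g v) = X i (c + g u)
  have e2 : X j * (a - ((∏ k ∈ J, X k) - C b) * v) = X i * (c + ((∏ k ∈ J, X k) - C b) * u) := by
    linear_combination hh
  have h3 : X i ∣ X j * (a - ((∏ k ∈ J, X k) - C b) * v) := ⟨_, e2⟩
  rcases X_prime.dvd_or_dvd h3 with h4 | ⟨w, hw⟩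
  · exact absurd (X_dvd_X.mp h4) hij
  · refine ⟨Ideal.Quotient.mk _ w, ?_⟩
    rw [gx, ← map_mul, Ideal.Quotient.eq, Ideal.mem_span_singleton]
    exact ⟨v, by rw [← hw]; ring⟩

theorem gx_pow_dvd (hb : b ≠ 0) {i j : σ} (hi : i ∈ J) (hj : j ∈ J) (hij : i ≠ j) (m k : ℕ)
    (a : GenStd J b) (h : gx J b i ^ m ∣ gx J b j ^ k * a) : gx J b i ^ m ∣ a := by
  induction k with
  | zero => simpa using h
  | succ k ih =>
    apply ih
    clear ih
    rw [pow_succ', mul_assoc] at h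
    generalize gx J b j ^ k * a = a' at h
    induction m generalizing a' with
    | zero => simp
    | succ m ih2 =>
      have h1 : gx J b i ∣ a' := gx_dvd hb hi hj hij a' (dvd_trans (dvd_pow_self _ (by simp)) h)
      obtain ⟨d, rfl⟩ := h1
      rw [pow_succ']
      apply mul_dvd_mul_left
      apply ih2
      obtain ⟨e, he⟩ := h
      refine ⟨e, ?_⟩
      rw [← sub_eq_zero]
      apply gx_nzd hb hi
      rw [pow_succ'] at he
      linear_combination he


variable [DecidableEq σ]

/-- inclusion of the polynomial ring in all variables but `i`. -/
noncomputable def gι (J : Finset σ) (b : R) (i : σ) : MvPolynomial {j // j ≠ i} R →+* GenStd J b :=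
  (Ideal.Quotient.mk _).comp (rename (Subtype.val : {j // j ≠ i} → σ)).toRingHom

/-- product of the other variables. -/
noncomputable def gy (J : Finset σ) (b : R) (i : σ) : GenStd J b := ∏ j ∈ J.erase i, gx J b j

theorem gι_y (i : σ) : gι J b i (∏ j ∈ J.subtype (· ≠ i), X j) = gy J b i := by
  simp only [gι, gy, gx]
  rw [RingHom.comp_apply]
  simp only [AlgHom.toRingHom_eq_coe, RingHom.coe_coe, map_prod, rename_X]
  rw [Finset.prod_subtype_eq_prod_filter (s := J) (p := (· ≠ i))
    (f := fun j => (Ideal.Quotient.mk (Ideal.span {(∏ j ∈ J, X j : MvPolynomial σ R) - C b})) (X j))]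
  rw [Finset.filter_ne']

theorem gx_mul_gy {i : σ} (hi : i ∈ J) : gx J b i * gy J b i = Ideal.Quotient.mk _ (C b) := by
  rw [gy, Finset.mul_prod_erase J (gx J b) hi]
  simp only [gx]
  rw [← map_prod, Ideal.Quotient.eq]
  exact Ideal.subset_span rfl

theorem gι_X (i : σ) (j : {j // j ≠ i}) : gι J b i (X j) = gx J b j := by
  simp [gι, gx]

theorem gι_C (i : σ) (r : R) : gι J b i (C r) = Ideal.Quotient.mk _ (C r) := by
  simp [gι]

theorem exists_gy_pow_mul {i : σ} (hi : i ∈ J) (a : GenStd J b) :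
    ∃ m, ∃ β, gy J b i ^ m * a = gι J b i β := by
  obtain ⟨a, rfl⟩ := Ideal.Quotient.mk_surjective a
  induction a using MvPolynomial.induction_on with
  | C r => exact ⟨0, C r, by simp [gι_C]⟩
  | add p q hp hq =>
    obtain ⟨m, β, h1⟩ := hp
    obtain ⟨k, γ, h2⟩ := hq
    refine ⟨m + k, (∏ j ∈ J.subtype (· ≠ i), X j) ^ k * β + (∏ j ∈ J.subtype (· ≠ i), X j) ^ m * γ, ?_⟩
    rw [map_add, map_add, map_mul, map_mul, map_pow, map_pow, gι_y, ← h1, ← h2]; ring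
  | mul_X p j hp =>
    obtain ⟨m, β, h1⟩ := hp
    by_cases hj : j = i
    · subst hj
      refine ⟨m + 1, β * C b, ?_⟩
      have := gx_mul_gy (b := b) hi
      rw [map_mul, map_mul, ← h1, gι_C, ← this, gx]; ring
    · refine ⟨m, β * X ⟨j, hj⟩, ?_⟩
      rw [map_mul, map_mul, ← h1, gι_X, gx]; ring

/-- auxiliary map to the fraction field. -/
noncomputable def gφ0 (J : Finset σ) (b : R) (i : σ) :
    MvPolynomial σ R →+* FractionRing (MvPolynomial {j // j ≠ i} R) :=
  eval₂Hom (algebraMap R _) (fun j => if h : j = i then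
    algebraMap (MvPolynomial {j // j ≠ i} R) _ (C b) /
      algebraMap (MvPolynomial {j // j ≠ i} R) _ (∏ j ∈ J.subtype (· ≠ i), X j) else
    algebraMap (MvPolynomial {j // j ≠ i} R) _ (X ⟨j, h⟩))

theorem gφ0_X {i j : σ} (h : j ≠ i) : gφ0 J b i (X j) =
    algebraMap (MvPolynomial {j // j ≠ i} R) _ (X ⟨j, h⟩) := by
  simp [gφ0, h]

theorem gφ0_rename {i : σ} (p : MvPolynomial {j // j ≠ i} R) :
    gφ0 J b i (rename Subtype.val p) = algebraMap _ _ p := by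
  induction p using MvPolynomial.induction_on with
  | C r =>
    simp only [rename_C]
    simp only [gφ0, eval₂Hom_C]
    exact IsScalarTower.algebraMap_apply R (MvPolynomial {j // j ≠ i} R) _ r
  | add p q hp hq => simp [hp, hq]
  | mul_X p j hp => rw [map_mul, map_mul, hp, map_mul, rename_X, gφ0_X j.2]

theorem gφ0_rel {i : σ} (hi : i ∈ J) : gφ0 J b i ((∏ j ∈ J, X j) - C b) = 0 := by
  rw [map_sub, map_prod, ← Finset.mul_prod_erase J _ hi, sub_eq_zero]
  have h1 : ∏ j ∈ J.erase i, gφ0 J b i (X j) =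
      algebraMap (MvPolynomial {j // j ≠ i} R) _ (∏ j ∈ J.subtype (· ≠ i), X j) := by
    rw [← gφ0_rename (J := J) (b := b), map_prod, map_prod]
    simp only [rename_X]
    rw [Finset.prod_subtype_eq_prod_filter (s := J) (p := (· ≠ i)) (f := fun j => gφ0 J b i (X j)),
      Finset.filter_ne']
  have h2 : gφ0 J b i (X i) = algebraMap (MvPolynomial {j // j ≠ i} R) _ (C b) /
      algebraMap (MvPolynomial {j // j ≠ i} R) _ (∏ j ∈ J.subtype (· ≠ i), X j) := by
    simp [gφ0]
  have h3 : algebraMap (MvPolynomial {j // j ≠ i} R) (FractionRing (MvPolynomial {j // j ≠ i} R))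
      (∏ j ∈ J.subtype (· ≠ i), X j) ≠ 0 := by
    rw [Ne, FaithfulSMul.algebraMap_eq_zero_iff]
    exact Finset.prod_ne_zero_iff.mpr fun j _ => X_ne_zero j
  rw [h1, h2, div_mul_cancel₀ _ h3, ← gφ0_rename (J := J) (b := b), rename_C]

/-- the map to the fraction field. -/
noncomputable def gφ (J : Finset σ) (b : R) {i : σ} (hi : i ∈ J) :
    GenStd J b →+* FractionRing (MvPolynomial {j // j ≠ i} R) :=
  Ideal.Quotient.lift _ (gφ0 J b i) (fun a ha => by
    rw [Ideal.mem_span_singleton] at ha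
    obtain ⟨c, rfl⟩ := ha
    rw [map_mul, gφ0_rel hi, zero_mul])

theorem gφ_gι {i : σ} (hi : i ∈ J) (p) : gφ J b hi (gι J b i p) = algebraMap _ _ p := by
  rw [← gφ0_rename (J := J) (b := b)]
  simp [gφ, gι]

theorem gι_injective {i : σ} (hi : i ∈ J) : Function.Injective (gι J b i) := by
  intro p q h
  have := congrArg (gφ J b hi) h
  rw [gφ_gι, gφ_gι] at this
  exact IsFractionRing.injective _ _ this

theorem gy_nzd (hb : b ≠ 0) {i : σ} (m : ℕ) (a : GenStd J b) (h : gy J b i ^ m * a = 0) :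
    a = 0 := by
  have h1 : ∀ j ∈ J, gx J b j ∈ nonZeroDivisors (GenStd J b) := fun j hj => by
    rw [mem_nonZeroDivisors_iff_left]
    exact gx_nzd hb hj
  have h2 : gy J b i ^ m ∈ nonZeroDivisors (GenStd J b) :=
    pow_mem (Submonoid.prod_mem _ fun j hj => h1 j (Finset.mem_of_mem_erase hj)) m
  exact (mem_nonZeroDivisors_iff_left.mp h2) a h

theorem gφ_injective (hb : b ≠ 0) {i : σ} (hi : i ∈ J) : Function.Injective (gφ J b hi) := by
  rw [injective_iff_map_eq_zero]
  intro a ha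
  obtain ⟨m, β, h⟩ := exists_gy_pow_mul hi a
  have h1 := congrArg (gφ J b hi) h
  rw [map_mul, ha, mul_zero, gφ_gι] at h1
  have h2 : β = 0 := by
    rw [eq_comm, FaithfulSMul.algebraMap_eq_zero_iff] at h1
    exact h1
  rw [h2, map_zero] at h
  exact gy_nzd hb m a h

theorem genStd_isDomain (hb : b ≠ 0) {i : σ} (hi : i ∈ J) : IsDomain (GenStd J b) :=
  (gφ_injective hb hi).isDomain

theorem gy_pow_mul_mem [IsIntegrallyClosed R] [IsDomain (GenStd J b)] {i : σ} (hi : i ∈ J)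
    (hb : b ≠ 0) {F : Type*} [Field F] [Algebra (GenStd J b) F] [IsFractionRing (GenStd J b) F]
    (x : F) (hx : IsIntegral (GenStd J b) x) :
    ∃ m a, algebraMap _ _ (gy J b i ^ m) * x = algebraMap (GenStd J b) F a := by
  set B := MvPolynomial {j // j ≠ i} R
  have hy0 : gy J b i ≠ 0 := fun h0 => by
    have := gy_nzd hb (i := i) 1 1 (by rw [h0]; simp)
    exact one_ne_zero this
  let algBA : Algebra B (GenStd J b) := (gι J b i).toAlgebra
  let algBF : Algebra B F := ((algebraMap (GenStd J b) F).comp (gι J b i)).toAlgebra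
  have tow : ∀ p : B, algebraMap B F p = algebraMap (GenStd J b) F (gι J b i p) := fun p => rfl
  have inj : Function.Injective (algebraMap B F) :=
    (IsFractionRing.injective (GenStd J b) F).comp (gι_injective hi)
  have hfs : FaithfulSMul B F := (faithfulSMul_iff_algebraMap_injective B F).mpr inj
  have hfr : IsFractionRing B F := by
    refine IsFractionRing.of_field B F fun z => ?_
    obtain ⟨p, q, hq, rfl⟩ := IsFractionRing.div_surjective (A := GenStd J b) z
    obtain ⟨m, β, h1⟩ := exists_gy_pow_mul hi p
    obtain ⟨k, γ, h2⟩ := exists_gy_pow_mul hi q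
    refine ⟨(∏ j ∈ J.subtype (· ≠ i), X j) ^ k * β, (∏ j ∈ J.subtype (· ≠ i), X j) ^ m * γ, ?_⟩
    rw [tow, tow, map_mul (gι J b i), map_mul (gι J b i), map_pow (gι J b i), map_pow (gι J b i), gι_y,
      ← h1, ← h2]
    have hq0 : algebraMap (GenStd J b) F q ≠ 0 := by
      exact (map_ne_zero_iff _ (IsFractionRing.injective (GenStd J b) F)).mpr (nonZeroDivisors.ne_zero hq)
    have hyF : algebraMap (GenStd J b) F (gy J b i) ≠ 0 := by
      exact (map_ne_zero_iff _ (IsFractionRing.injective (GenStd J b) F)).mpr hy0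
    simp only [map_mul, map_pow]
    field_simp
  have hBn : IsIntegrallyClosed B := mvPoly_isIntegrallyClosed _
  obtain ⟨P, hP, hPx⟩ := hx
  -- uniform denominator
  have hden : ∃ m, ∀ k, ∃ β, gy J b i ^ m * P.coeff k = gι J b i β := by
    choose m β hβ using fun k => exists_gy_pow_mul hi (P.coeff k)
    refine ⟨∑ k ∈ P.support, m k, fun k => ?_⟩
    by_cases hk : k ∈ P.support
    · refine ⟨(∏ j ∈ J.subtype (· ≠ i), X j) ^ (∑ l ∈ P.support.erase k, m l) * β k, ?_⟩
      rw [map_mul, map_pow, gι_y, ← hβ, ← Finset.sum_erase_add _ _ hk, pow_add]; ring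
    · rw [Polynomial.notMem_support_iff] at hk
      exact ⟨0, by rw [hk]; simp⟩
  obtain ⟨m, hm⟩ := hden
  set Q := P.scaleRoots (gy J b i ^ m) with hQ
  have hQm : Q.Monic := (Polynomial.monic_scaleRoots_iff _).mpr hP
  have hQl : Q ∈ Polynomial.lifts (gι J b i) := by
    rw [Polynomial.lifts_iff_coeff_lifts]
    intro k
    rw [hQ, Polynomial.coeff_scaleRoots]
    by_cases hk : k < P.natDegree
    · obtain ⟨β, hβ⟩ := hm k
      obtain ⟨d, hd⟩ : ∃ d, P.natDegree - k = d + 1 := ⟨P.natDegree - k - 1, by omega⟩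
      refine ⟨β * ((∏ j ∈ J.subtype (· ≠ i), X j) ^ m) ^ d, ?_⟩
      rw [map_mul, map_pow, map_pow, gι_y, ← hβ, hd]; ring
    · rcases (not_lt.mp hk).eq_or_lt with h | h
      · refine ⟨1, ?_⟩
        rw [← h]; simp [hP]
      · refine ⟨0, ?_⟩
        rw [Polynomial.coeff_eq_zero_of_natDegree_lt h]; simp
  obtain ⟨Q', hQ', -, hQ'm⟩ := Polynomial.lifts_and_natDegree_eq_and_monic hQl hQm
  have hintg : IsIntegral B (algebraMap _ F (gy J b i ^ m) * x) := by
    refine ⟨Q', hQ'm, ?_⟩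
    have : algebraMap B F = (algebraMap (GenStd J b) F).comp (gι J b i) := rfl
    rw [this, ← Polynomial.eval₂_map, hQ']
    exact Polynomial.scaleRoots_aeval_eq_zero hPx
  obtain ⟨β, hβ⟩ := IsIntegrallyClosed.algebraMap_eq_of_integral hintg
  exact ⟨m, gι J b i β, hβ.symm⟩

theorem genStd_isIntegrallyClosed [IsIntegrallyClosed R] [IsDomain (GenStd J b)] {i : σ}
    (hi : i ∈ J) (hb : b ≠ 0) : IsIntegrallyClosed (GenStd J b) := by
  rw [isIntegrallyClosed_iff (FractionRing (GenStd J b))]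
  let F := FractionRing (GenStd J b)
  intro (x : F) hx
  choose! m a hma using fun i (hi : i ∈ J) => gy_pow_mul_mem hi hb x hx
  set M := ∑ i ∈ J, m i
  have hx0 : ∀ i ∈ J, algebraMap (GenStd J b) F (gx J b i) ≠ 0 := fun i hi h0 => by
    rw [FaithfulSMul.algebraMap_eq_zero_iff] at h0
    have := gx_nzd hb hi 1 (by rw [h0]; simp)
    exact one_ne_zero this
  have base : ∀ i ∈ J, ∃ a, algebraMap (GenStd J b) F ((∏ j ∈ J.erase i, gx J b j) ^ M) * x =
      algebraMap (GenStd J b) F a := by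
    intro i hi
    refine ⟨gy J b i ^ (∑ l ∈ J.erase i, m l) * a i, ?_⟩
    rw [map_mul, ← hma i hi, ← gy]
    have : M = ∑ l ∈ J.erase i, m l + m i := (Finset.sum_erase_add _ _ hi).symm
    rw [this, pow_add, map_mul]; ring
  have key : ∀ r : ℕ, ∀ T ⊆ J, T.card + r + 1 = J.card →
      ∃ a, algebraMap (GenStd J b) F ((∏ j ∈ T, gx J b j) ^ M) * x =
      algebraMap (GenStd J b) F a := by
    intro r
    induction r with
    | zero =>
      intro T hT hc
      have h1 : (J \ T).card = 1 := by rw [Finset.card_sdiff_of_subset hT]; omega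
      obtain ⟨i, hiT⟩ := Finset.card_eq_one.mp h1
      have hiJ : i ∈ J \ T := by rw [hiT]; simp
      have : T = J.erase i := by
        rw [← Finset.sdiff_singleton_eq_erase, ← hiT, Finset.sdiff_sdiff_eq_self hT]
      rw [this]
      exact base i (Finset.mem_sdiff.mp hiJ).1
    | succ r ih =>
      intro T hT hc
      have h1 : 1 < (J \ T).card := by rw [Finset.card_sdiff_of_subset hT]; omega
      obtain ⟨i, hi', j, hj', hij⟩ := Finset.one_lt_card.mp h1
      rw [Finset.mem_sdiff] at hi' hj'
      obtain ⟨α, hα⟩ := ih (insert i T) (Finset.insert_subset hi'.1 hT)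
        (by rw [Finset.card_insert_of_notMem hi'.2]; omega)
      obtain ⟨β, hβ⟩ := ih (insert j T) (Finset.insert_subset hj'.1 hT)
        (by rw [Finset.card_insert_of_notMem hj'.2]; omega)
      rw [Finset.prod_insert hi'.2, mul_pow, map_mul, mul_assoc] at hα
      rw [Finset.prod_insert hj'.2, mul_pow, map_mul, mul_assoc] at hβ
      set u := algebraMap (GenStd J b) F ((∏ j ∈ T, gx J b j) ^ M) * x
      have h2 : gx J b i ^ M ∣ gx J b j ^ M * α := by
        refine ⟨β, ?_⟩
        apply IsFractionRing.injective (GenStd J b) F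
        rw [map_mul, map_mul, ← hα, ← hβ]; ring
      obtain ⟨γ, rfl⟩ := gx_pow_dvd hb hi'.1 hj'.1 hij M M α h2
      refine ⟨γ, ?_⟩
      rw [map_mul] at hα
      refine mul_left_cancel₀ ?_ hα
      rw [map_pow]
      exact pow_ne_zero _ (hx0 i hi'.1)
  have hpos : 0 < J.card := Finset.card_pos.mpr ⟨i, hi⟩
  obtain ⟨a, ha⟩ := key (J.card - 1) ∅ (by simp) (by simp; omega)
  exact ⟨a, by rw [← ha]; simp⟩

end std
end helpersA

open Polynomial in
theorem hens_core {R S : Type*} [CommRing R] [HenselianLocalRing R] [CommRing S] [IsDomain S]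
    [Algebra R S] (n : ℕ) (Y : Fin n → S) (P : R[X])
    (hP : P.map (algebraMap R S) = ∏ i, (X - C (Y i)))
    (M : Ideal S) [hM : M.IsPrime]
    (hMm : M.comap (algebraMap R S) = IsLocalRing.maximalIdeal R) (i0 : Fin n) (hi0 : Y i0 ∉ M) :
    IsUnit (Y i0) := by
  classical
  -- elementary symmetric functions lie in the image of `R`
  have hes : ∀ k : ℕ, (∑ I ∈ Finset.powersetCard k (Finset.univ : Finset (Fin n)),
      ∏ i ∈ I, Y i) ∈ (algebraMap R S).range := by
    intro k
    by_cases hk : k ≤ n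
    · have h1 := Multiset.prod_X_sub_C_coeff (Multiset.map Y Finset.univ.val) (k := n - k)
        (by simp)
      have h2 : (Multiset.map (fun t => X - C t) (Multiset.map Y Finset.univ.val)).prod
          = P.map (algebraMap R S) := by
        rw [hP, Multiset.map_map]; rfl
      rw [h2, coeff_map] at h1
      have h3 : (Multiset.map Y Finset.univ.val).esymm k = ∑ I ∈ Finset.powersetCard k
          (Finset.univ : Finset (Fin n)), ∏ i ∈ I, Y i := Finset.esymm_map_val _ _ _
      rw [← h3]
      have h4 : Multiset.card (Multiset.map Y Finset.univ.val) - (n - k) = k := by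
        simp; omega
      rw [h4] at h1
      refine ⟨(-1)^k * P.coeff (n-k), ?_⟩
      rw [map_mul, h1, ← mul_assoc]
      simp [← mul_pow]
    · rw [Finset.powersetCard_eq_empty.2 (by simpa using hk)]
      simp
  set I1 : Finset (Fin n) := Finset.univ.filter (fun i => Y i ∉ M) with hI1
  set d := I1.card with hd
  set PS := Finset.powersetCard d (Finset.univ : Finset (Fin n)) with hPS
  let z : Finset (Fin n) → S := fun I => ∏ i ∈ I, Y i
  have hI1P : I1 ∈ PS := by simp [hPS, hd]
  have hzI : ∀ I ∈ PS, I ≠ I1 → z I ∈ M := by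
    intro I hI hne
    have hc : I.card = d := (Finset.mem_powersetCard.1 hI).2
    have : ¬ I ⊆ I1 := fun h => hne (Finset.eq_of_subset_of_card_le h (by omega))
    obtain ⟨i, hi, hi'⟩ := Finset.not_subset.1 this
    have : Y i ∈ M := by simpa [hI1] using hi'
    exact Ideal.mem_of_dvd M (Finset.dvd_prod_of_mem Y hi) this
  have hzI1 : z I1 ∉ M := by
    intro h
    obtain ⟨i, hi, hi'⟩ := (Ideal.IsPrime.prod_mem_iff).1 h
    exact (Finset.mem_filter.1 hi).2 hi'
  -- the polynomial G
  let G : S[X] := ∏ I ∈ PS, (X - C (z I))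
  have hG : G ∈ lifts (algebraMap R S) := by
    let GU : (MvPolynomial (Fin n) R)[X] := ∏ I ∈ PS, (X - C (∏ i ∈ I, MvPolynomial.X i))
    have hGU : GU.map (MvPolynomial.aeval Y : MvPolynomial (Fin n) R →ₐ[R] S).toRingHom = G := by
      simp only [GU, G, Polynomial.map_prod, Polynomial.map_sub, Polynomial.map_X,
        Polynomial.map_C]
      refine Finset.prod_congr rfl fun I _ => ?_
      simp [z]
    rw [lifts_iff_coeff_lifts]
    intro k
    have hsym : (GU.coeff k).IsSymmetric := by
      intro e
      have : GU.map (MvPolynomial.rename e : MvPolynomial (Fin n) R →ₐ[R] _).toRingHom = GU := by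
        simp only [GU, Polynomial.map_prod, Polynomial.map_sub, Polynomial.map_X,
          Polynomial.map_C]
        refine Finset.prod_bij' (fun I _ => I.map e.toEmbedding) (fun I _ => I.map e.symm.toEmbedding)
          ?_ ?_ ?_ ?_ ?_
        · intro I hI; simpa [hPS] using hI
        · intro I hI; simpa [hPS] using hI
        · intro I hI; ext; simp
        · intro I hI; ext; simp
        · intro I hI; simp
      conv_rhs => rw [← this]
      rw [coeff_map]; rfl
    obtain ⟨q, hq⟩ := MvPolynomial.esymmAlgHom_surjective R (n := n) (σ := Fin n) (by simp)
      ⟨GU.coeff k, hsym⟩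
    have hq' : MvPolynomial.aeval (fun i : Fin n => MvPolynomial.esymm (Fin n) R (i+1)) q
        = GU.coeff k := by
      have := congrArg Subtype.val hq
      simpa [MvPolynomial.esymmAlgHom_apply] using this
    have : G.coeff k = MvPolynomial.aeval
        (fun i : Fin n => (MvPolynomial.aeval Y (MvPolynomial.esymm (Fin n) R (i+1)) : S)) q := by
      rw [← hGU, coeff_map, ← hq']
      change MvPolynomial.aeval Y _ = _
      rw [← MvPolynomial.comp_aeval_apply]
    rw [this]
    have hr : ∀ i : Fin n, (MvPolynomial.aeval Y (MvPolynomial.esymm (Fin n) R (i+1)) : S)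
        ∈ (algebraMap R S).range := by
      intro i
      have := hes (i+1)
      rw [MvPolynomial.esymm, map_sum]
      simpa [map_prod] using this
    choose r hr using hr
    refine ⟨MvPolynomial.aeval r q, ?_⟩
    simp only [← hr]
    exact (MvPolynomial.comp_aeval_apply (f := r) (Algebra.ofId R S) q)
  have hGm : G.Monic := monic_prod_X_sub_C _ _
  obtain ⟨G0, hG0, -, hG0m⟩ := lifts_and_natDegree_eq_and_monic hG hGm
  obtain ⟨a0, ha0⟩ := hes d
  have ha0z : algebraMap R S a0 - z I1 ∈ M := by
    rw [ha0, ← Finset.add_sum_erase _ _ hI1P]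
    simp only [z, add_sub_cancel_left]
    refine Ideal.sum_mem _ fun I hI => hzI I (Finset.mem_of_mem_erase hI) (Finset.ne_of_mem_erase hI)
  have hev : ∀ a : R, algebraMap R S (G0.eval a) = ∏ I ∈ PS, (algebraMap R S a - z I) := by
    intro a
    rw [← Polynomial.aeval_algebraMap_apply_eq_algebraMap_eval, ← Polynomial.eval_map_algebraMap,
      hG0]
    simp [G, Polynomial.eval_prod]
  have hmem : ∀ a : R, a ∈ IsLocalRing.maximalIdeal R ↔ algebraMap R S a ∈ M := by
    intro a; rw [← hMm]; rfl
  have hroot : G0.eval a0 ∈ IsLocalRing.maximalIdeal R := by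
    rw [hmem, hev]
    exact Ideal.mem_of_dvd M (Finset.dvd_prod_of_mem _ hI1P) ha0z
  have hder : IsUnit (G0.derivative.eval a0) := by
    rw [← not_not (a := IsUnit _), ← mem_nonunits_iff, ← IsLocalRing.mem_maximalIdeal, hmem]
    rw [← Polynomial.aeval_algebraMap_apply_eq_algebraMap_eval, ← Polynomial.eval_map_algebraMap,
      ← Polynomial.derivative_map, hG0]
    have hGe : G = (X - C (z I1)) * ∏ I ∈ PS.erase I1, (X - C (z I)) :=
      (Finset.mul_prod_erase _ _ hI1P).symm
    rw [hGe, Polynomial.derivative_mul]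
    simp only [Polynomial.derivative_sub, Polynomial.derivative_X, Polynomial.derivative_C,
      sub_zero, one_mul, Polynomial.eval_add, Polynomial.eval_mul, Polynomial.eval_sub,
      Polynomial.eval_X, Polynomial.eval_C]
    intro h
    have h2 := (M.add_mem_iff_left (M.mul_mem_right _ ha0z)).1 h
    rw [Polynomial.eval_prod] at h2
    obtain ⟨I, hI, hI'⟩ := (Ideal.IsPrime.prod_mem_iff).1 h2
    simp only [Polynomial.eval_sub, Polynomial.eval_X, Polynomial.eval_C] at hI'
    have h3 := hzI I (Finset.mem_of_mem_erase hI) (Finset.ne_of_mem_erase hI)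
    apply hzI1
    have : z I1 = (algebraMap R S a0 - z I) + z I - (algebraMap R S a0 - z I1) := by ring
    rw [this]
    exact M.sub_mem (M.add_mem hI' h3) ha0z
  obtain ⟨a, ha, haa0⟩ := HenselianLocalRing.is_henselian G0 hG0m a0 hroot hder
  have haz : algebraMap R S a - z I1 ∈ M := by
    have := M.add_mem ((hmem _).1 haa0) ha0z
    simpa using this
  have haM : algebraMap R S a ∉ M := fun h => hzI1 (by
    have := M.sub_mem h haz
    simpa using this)
  have hau : IsUnit a := by
    rw [← not_not (a := IsUnit _), ← mem_nonunits_iff, ← IsLocalRing.mem_maximalIdeal, hmem]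
    exact haM
  have h0 := hev a
  rw [ha.eq_zero, map_zero] at h0
  obtain ⟨I, hI, hIa⟩ := Finset.prod_eq_zero_iff.1 h0.symm
  have hII1 : I = I1 := by
    by_contra hne
    exact haM (by rw [sub_eq_zero.1 hIa]; exact hzI I hI hne)
  rw [hII1] at hIa
  have hu : IsUnit (z I1) := by
    rw [← sub_eq_zero.1 hIa]; exact hau.map _
  exact isUnit_of_dvd_unit (Finset.dvd_prod_of_mem Y (by simp [hI1, hi0])) hu

/-- The integral closure of a henselian local ring in an algebraically closed field has at most
one prime above the maximal ideal. -/
theorem hens_unique {R L : Type*} [CommRing R] [HenselianLocalRing R] [Field L] [IsAlgClosed L]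
    [Algebra R L] (M₁ M₂ : Ideal (integralClosure R L)) [M₁.IsPrime] [M₂.IsPrime]
    (h₁ : M₁.comap (algebraMap R _) = IsLocalRing.maximalIdeal R)
    (h₂ : M₂.comap (algebraMap R _) = IsLocalRing.maximalIdeal R) : M₁ = M₂ := by
  have key : ∀ (M : Ideal (integralClosure R L)) [M.IsPrime],
      M.comap (algebraMap R _) = IsLocalRing.maximalIdeal R → ∀ y, y ∉ M → IsUnit y := by
    intro M _ hM y hy
    obtain ⟨P, hPm, hP⟩ := (integralClosure.isIntegral (R := R) (A := L) y)
    have hs : (P.map (algebraMap R L)).Splits := IsAlgClosed.splits _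
    set rts := (P.map (algebraMap R L)).roots with hrts
    have hprod := hs.eq_prod_roots_of_monic (hPm.map (algebraMap R L))
    have hintg : ∀ t ∈ rts, t ∈ integralClosure R L := by
      intro t ht
      refine ⟨P, hPm, ?_⟩
      have := (Polynomial.mem_roots'.1 ht).2
      rwa [Polynomial.IsRoot, Polynomial.eval_map] at this
    let lst := rts.toList
    let Y : Fin lst.length → integralClosure R L := fun i =>
      ⟨lst.get i, hintg _ (by rw [← Multiset.mem_toList]; exact List.get_mem _ _)⟩
    have hPY : P.map (algebraMap R (integralClosure R L)) = ∏ i,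
        (Polynomial.X - Polynomial.C (Y i)) := by
      apply Polynomial.map_injective (algebraMap (integralClosure R L) L)
        (FaithfulSMul.algebraMap_injective _ _)
      rw [Polynomial.map_map, ← IsScalarTower.algebraMap_eq, hprod, Polynomial.map_prod]
      simp only [Polynomial.map_sub, Polynomial.map_X, Polynomial.map_C]
      rw [← hrts, ← Multiset.coe_toList rts, Multiset.map_coe, Multiset.prod_coe]
      exact (Fin.prod_univ_fun_getElem lst (fun a => Polynomial.X - Polynomial.C a)).symm
    have hyr : (y : L) ∈ rts := by
      rw [Polynomial.mem_roots (hPm.map _).ne_zero, Polynomial.IsRoot, Polynomial.eval_map]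
      have := congrArg (algebraMap (integralClosure R L) L) hP
      rw [Polynomial.hom_eval₂, map_zero, ← IsScalarTower.algebraMap_eq] at this
      exact this
    obtain ⟨i, hi⟩ := List.mem_iff_get.1 (Multiset.mem_toList.2 hyr)
    have hyi : y = Y i := Subtype.ext hi.symm
    rw [hyi] at hy ⊢
    exact hens_core _ Y P hPY M hM i hy
  apply le_antisymm
  · intro y hy
    by_contra h
    exact Ideal.IsPrime.ne_top ‹_› (Ideal.eq_top_of_isUnit_mem _ hy (key M₂ h₂ y h))
  · intro y hy
    by_contra h
    exact Ideal.IsPrime.ne_top ‹_› (Ideal.eq_top_of_isUnit_mem _ hy (key M₁ h₁ y h))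
open TensorProduct in
/-- Over a normal domain, an étale algebra has at most one generic prime below a given prime. -/
theorem etale_normal_unique {A T : Type*} [CommRing A] [IsDomain A] [IsIntegrallyClosed A]
    [CommRing T] [Algebra A T] [Algebra.Etale A T] (N₁ N₂ q : Ideal T) [N₁.IsPrime] [N₂.IsPrime]
    [hq : q.IsPrime] (h₁ : N₁.comap (algebraMap A T) = ⊥) (h₂ : N₂.comap (algebraMap A T) = ⊥)
    (hq₁ : N₁ ≤ q) (hq₂ : N₂ ≤ q) : N₁ = N₂ := by
  let K := FractionRing A
  let D := T ⊗[A] K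
  have hloc : IsLocalization (Algebra.algebraMapSubmonoid T (nonZeroDivisors A)) D :=
    inferInstance
  have hArt : IsArtinianRing D := by
    have : Module.Finite K (K ⊗[A] T) := Algebra.FormallyUnramified.finite_of_free _ _
    have h2 : IsArtinianRing (K ⊗[A] T) := IsArtinianRing.of_finite K _
    exact (Algebra.TensorProduct.comm A K T).toRingEquiv.isArtinianRing
  have hdisj : ∀ N : Ideal T, N.comap (algebraMap A T) = ⊥ →
      Disjoint (Algebra.algebraMapSubmonoid T (nonZeroDivisors A) : Set T) (N : Set T) := by
    intro N hN
    rw [Set.disjoint_left]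
    rintro _ ⟨a, ha, rfl⟩ h
    have : a ∈ N.comap (algebraMap A T) := h
    rw [hN] at this
    exact nonZeroDivisors.ne_zero ha this
  have hp : ∀ N : Ideal T, N.IsPrime → N.comap (algebraMap A T) = ⊥ →
      ∃ P : PrimeSpectrum D, P.asIdeal.comap (algebraMap T D) = N := by
    intro N hN h
    refine ⟨⟨N.map (algebraMap T D), IsLocalization.isPrime_of_isPrime_disjoint _ D N hN (hdisj N h)⟩, ?_⟩
    exact IsLocalization.under_map_of_isPrime_disjoint _ D hN (hdisj N h)
  obtain ⟨P₁, hP₁⟩ := hp N₁ inferInstance h₁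
  obtain ⟨P₂, hP₂⟩ := hp N₂ inferInstance h₂
  by_cases hne : P₁ = P₂
  · rw [← hP₁, ← hP₂, hne]
  exfalso
  obtain ⟨e, he, heP⟩ := PrimeSpectrum.exists_idempotent_basicOpen_eq_of_isClopen
    (isClopen_discrete ({P₁}ᶜ : Set (PrimeSpectrum D)))
  have he1 : e ∈ P₁.asIdeal := by
    by_contra h
    have : P₁ ∈ (PrimeSpectrum.basicOpen e : Set (PrimeSpectrum D)) := h
    rw [← heP] at this
    exact this rfl
  have he2 : 1 - e ∈ P₂.asIdeal := by
    have h : P₂ ∈ ({P₁}ᶜ : Set (PrimeSpectrum D)) := fun h => hne h.symm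
    rw [heP] at h
    have h' : e ∉ P₂.asIdeal := h
    refine (P₂.isPrime.mem_or_mem (x := e) (y := 1 - e) ?_).resolve_left h'
    rw [mul_sub, mul_one, he.eq, sub_self]; exact zero_mem _
  have hintg : IsIntegral T e := by
    refine ⟨Polynomial.X ^ 2 - Polynomial.X, ?_, ?_⟩
    · monicity!
    · simp [pow_two, he.eq]
  obtain ⟨w, hw⟩ := (TensorProduct.toIntegralClosure_bijective_of_smooth (R := A) (S := T) (B := K)).2
    ⟨e, hintg⟩
  have hrange : ∀ w : T ⊗[A] (integralClosure A K), ∃ t : T,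
      algebraMap T D t = (TensorProduct.toIntegralClosure A T K w : D) := by
    intro w
    induction w using TensorProduct.induction_on with
    | zero => exact ⟨0, by simp⟩
    | add x y hx hy =>
      obtain ⟨a, ha⟩ := hx
      obtain ⟨b, hb⟩ := hy
      exact ⟨a + b, by simp [ha, hb]⟩
    | tmul t x =>
      obtain ⟨a, ha⟩ := IsIntegrallyClosed.algebraMap_eq_of_integral (R := A) x.2
      refine ⟨a • t, ?_⟩
      have : (TensorProduct.toIntegralClosure A T K (t ⊗ₜ x) : D) = t ⊗ₜ (x : K) := rfl
      rw [this, ← ha, Algebra.algebraMap_eq_smul_one a, TensorProduct.tmul_smul,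
        TensorProduct.smul_tmul', Algebra.TensorProduct.algebraMap_apply]
      rfl
  obtain ⟨t, ht⟩ := hrange w
  rw [hw] at ht
  have ht : algebraMap T D t = e := ht
  have t1 : t ∈ N₁ := by rw [← hP₁]; rwa [Ideal.mem_comap, ht]
  have t2 : 1 - t ∈ N₂ := by rw [← hP₂]; rwa [Ideal.mem_comap, map_sub, map_one, ht]
  apply hq.ne_top
  rw [Ideal.eq_top_iff_one]
  have := q.add_mem (hq₁ t1) (hq₂ t2)
  simpa using this
theorem unique_over {R R' C T : Type*} [CommRing R] [IsLocalRing R]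
    [IsSepClosed (IsLocalRing.ResidueField R)] [CommRing R'] [CommRing C] [CommRing T]
    [Algebra R R'] [Algebra.IsIntegral R R'] [Algebra R C] [Algebra R' T] [Algebra C T]
    (hcomm : ∀ r : R, algebraMap R' T (algebraMap R R' r) = algebraMap C T (algebraMap R C r))
    (hadj : Algebra.adjoin C (Set.range (algebraMap R' T)) = ⊤)
    (M : Ideal R') [M.IsPrime] (hM : M.comap (algebraMap R R') = IsLocalRing.maximalIdeal R)
    (Q₁ Q₂ : Ideal T) [Q₁.IsPrime] [Q₂.IsPrime]
    (hQ₁ : Q₁.comap (algebraMap R' T) = M) (hQ₂ : Q₂.comap (algebraMap R' T) = M)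
    (hQ : Q₁.comap (algebraMap C T) = Q₂.comap (algebraMap C T)) : Q₁ = Q₂ := by
  let k := IsLocalRing.ResidueField R
  let q := ringExpChar k
  let J : Ideal T := M.map (algebraMap R' T)
  have hJ₁ : J ≤ Q₁ := Ideal.map_le_iff_le_comap.2 hQ₁.ge
  have hJ₂ : J ≤ Q₂ := Ideal.map_le_iff_le_comap.2 hQ₂.ge
  have hJ : J ≠ ⊤ := fun h => Ideal.IsPrime.ne_top ‹Q₁.IsPrime› (top_le_iff.1 (h ▸ hJ₁))
  have : Nontrivial (T ⧸ J) := Ideal.Quotient.nontrivial_iff.2 hJ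
  let φ : k →+* T ⧸ J := Ideal.Quotient.lift (IsLocalRing.maximalIdeal R)
    ((Ideal.Quotient.mk J).comp ((algebraMap R' T).comp (algebraMap R R'))) (by
      intro a ha
      rw [← hM] at ha
      exact Ideal.Quotient.eq_zero_iff_mem.2 (Ideal.mem_map_of_mem _ ha))
  have hk : ExpChar k q := ringExpChar.expChar k
  have hTq : ExpChar (T ⧸ J) q := expChar_of_injective_ringHom φ.injective q
  -- elements of R'
  have hR' : ∀ y : R', ∃ (n : ℕ) (r : R), y ^ q ^ n - algebraMap R R' r ∈ M := by
    intro y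
    let ψ : k →+* R' ⧸ M := Ideal.quotientMap M (algebraMap R R') hM.ge
    let : Algebra k (R' ⧸ M) := ψ.toAlgebra
    have : IsScalarTower R k (R' ⧸ M) := IsScalarTower.of_algebraMap_eq' rfl
    have : Algebra.IsIntegral R (R' ⧸ M) := inferInstance
    have : Algebra.IsIntegral k (R' ⧸ M) := Algebra.IsIntegral.tower_top R
    have : Algebra.IsAlgebraic k (R' ⧸ M) := inferInstance
    have : IsPurelyInseparable k (R' ⧸ M) := inferInstance
    obtain ⟨n, c, hc⟩ := IsPurelyInseparable.pow_mem k q (Ideal.Quotient.mk M y)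
    obtain ⟨r, rfl⟩ := IsLocalRing.residue_surjective c
    refine ⟨n, r, ?_⟩
    rw [← Ideal.Quotient.eq_zero_iff_mem, map_sub, map_pow, ← hc, sub_eq_zero]
    rfl
  have hT : ∀ z : T, ∃ (n : ℕ) (c : C), Ideal.Quotient.mk J z ^ q ^ n
      = Ideal.Quotient.mk J (algebraMap C T c) := by
    intro z
    have hz : z ∈ Algebra.adjoin C (Set.range (algebraMap R' T)) := by rw [hadj]; trivial
    induction hz using Algebra.adjoin_induction with
    | mem x hx =>
      obtain ⟨y, rfl⟩ := hx
      obtain ⟨n, r, h⟩ := hR' y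
      refine ⟨n, algebraMap R C r, ?_⟩
      rw [← hcomm, ← map_pow, ← map_pow, ← sub_eq_zero, ← map_sub, ← map_sub,
        Ideal.Quotient.eq_zero_iff_mem]
      exact Ideal.mem_map_of_mem _ h
    | algebraMap c => exact ⟨0, c, by simp⟩
    | add x y _ _ hx hy =>
      obtain ⟨n, c, hc⟩ := hx
      obtain ⟨m, d, hd⟩ := hy
      refine ⟨n + m, c ^ q ^ m + d ^ q ^ n, ?_⟩
      rw [map_add, add_pow_expChar_pow, pow_add q, pow_mul, hc, mul_comm (q ^ n), pow_mul, hd]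
      simp
    | mul x y _ _ hx hy =>
      obtain ⟨n, c, hc⟩ := hx
      obtain ⟨m, d, hd⟩ := hy
      refine ⟨n + m, c ^ q ^ m * d ^ q ^ n, ?_⟩
      rw [map_mul, mul_pow, pow_add q, pow_mul, hc, mul_comm (q ^ n), pow_mul, hd]
      simp
  have key : ∀ (P₁ P₂ : Ideal T) [P₁.IsPrime] [P₂.IsPrime], J ≤ P₁ → J ≤ P₂ →
      P₁.comap (algebraMap C T) = P₂.comap (algebraMap C T) → P₁ ≤ P₂ := by
    intro P₁ P₂ _ hp2 hj1 hj2 h z hz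
    obtain ⟨n, c, hc⟩ := hT z
    rw [← map_pow, ← sub_eq_zero, ← map_sub, Ideal.Quotient.eq_zero_iff_mem] at hc
    have hq0 : q ^ n ≠ 0 := pow_ne_zero _ (expChar_pos k q).ne'
    have h1 : algebraMap C T c ∈ P₁ := by
      have := P₁.sub_mem (P₁.pow_mem_of_mem hz _ (Nat.pos_of_ne_zero hq0)) (hj1 hc)
      simpa using this
    have h2 : algebraMap C T c ∈ P₂ := by
      have : c ∈ P₁.comap (algebraMap C T) := h1
      rw [h] at this; exact this
    have h3 : z ^ q ^ n ∈ P₂ := by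
      have := P₂.add_mem (hj2 hc) h2
      simpa using this
    exact hp2.mem_of_pow_mem _ h3
  exact le_antisymm (key Q₁ Q₂ hJ₁ hJ₂ hQ) (key Q₂ Q₁ hJ₂ hJ₁ hQ.symm)
theorem main_abstract {R L A' C T : Type*} [CommRing R] [HenselianLocalRing R]
    [IsSepClosed (IsLocalRing.ResidueField R)] [Field L] [IsAlgClosed L] [Algebra R L]
    [CommRing A'] [IsDomain A'] [IsIntegrallyClosed A'] [CommRing C] [CommRing T]
    [Algebra R C] [Algebra (integralClosure R L) T] [Algebra C T]
    [Algebra A' T] [Algebra.Etale A' T]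
    (hcomm : ∀ r : R, algebraMap (integralClosure R L) T (algebraMap R _ r)
      = algebraMap C T (algebraMap R C r))
    (hadj : Algebra.adjoin C (Set.range (algebraMap (integralClosure R L) T)) = ⊤)
    (q q₁ q₂ : Ideal C) [q.IsPrime] (h₁ : q₁ ≤ q) (h₂ : q₂ ≤ q)
    (hqm : q.comap (algebraMap R C) = IsLocalRing.maximalIdeal R)
    (Q₁ Q₂ : Ideal T) [Q₁.IsPrime] [Q₂.IsPrime]
    (hQ₁ : Q₁.comap (algebraMap C T) = q₁) (hQ₂ : Q₂.comap (algebraMap C T) = q₂)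
    (hR₁ : Q₁.comap (algebraMap (integralClosure R L) T) = ⊥)
    (hmin₁ : ∀ q₀ : Ideal C, q₀.IsPrime → q₀ ≤ q₁ →
      q₀.comap (algebraMap R C) = RingHom.ker (algebraMap R L) → q₀ = q₁)
    (hmin₂ : ∀ q₀ : Ideal C, q₀.IsPrime → q₀ ≤ q₂ →
      q₀.comap (algebraMap R C) = RingHom.ker (algebraMap R L) → q₀ = q₂) : q₁ = q₂ := by
  have hcomm' : (algebraMap (integralClosure R L) T).comp (algebraMap R _)
      = (algebraMap C T).comp (algebraMap R C) := RingHom.ext hcomm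
  have hintg : Algebra.IsIntegral C T := by
    suffices h : Algebra.adjoin C (Set.range (algebraMap (integralClosure R L) T))
        ≤ integralClosure C T from ⟨fun x => h (by rw [hadj]; trivial)⟩
    rw [Algebra.adjoin_le_iff]
    rintro _ ⟨y, rfl⟩
    obtain ⟨P, hP, hy⟩ := integralClosure.isIntegral (R := R) (A := L) y
    refine ⟨P.map (algebraMap R C), hP.map _, ?_⟩
    have := congrArg (algebraMap (integralClosure R L) T) hy
    rw [Polynomial.hom_eval₂, map_zero, hcomm'] at this
    rwa [Polynomial.eval₂_map]
  obtain ⟨P₁, hP₁, hP₁p, hP₁q⟩ := Ideal.exists_ideal_over_prime_of_isIntegral q Q₁ (hQ₁ ▸ h₁)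
  obtain ⟨P₂, hP₂, hP₂p, hP₂q⟩ := Ideal.exists_ideal_over_prime_of_isIntegral q Q₂ (hQ₂ ▸ h₂)
  have hm : ∀ P : Ideal T, P.comap (algebraMap C T) = q →
      (P.comap (algebraMap (integralClosure R L) T)).comap (algebraMap R _)
        = IsLocalRing.maximalIdeal R := by
    intro P hP
    rw [Ideal.comap_comap, hcomm', ← Ideal.comap_comap, hP, hqm]
  have hP : P₁ = P₂ := by
    refine unique_over (R := R) hcomm hadj (P₁.comap (algebraMap (integralClosure R L) T)) (hm _ hP₁q) P₁ P₂ rfl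
      ?_ (hP₁q.trans hP₂q.symm)
    exact hens_unique _ _ (hm _ hP₂q) (hm _ hP₁q)
  have gd : ∀ Q : Ideal T, Q.IsPrime → ∃ N ≤ Q, N.IsPrime ∧ N.comap (algebraMap A' T) = ⊥ := by
    intro Q hQ
    have : (⊥ : Ideal A') ≤ Q.under A' := bot_le
    obtain ⟨N, hN, hNp, hNo⟩ := Ideal.exists_ideal_le_liesOver_of_le (R := A') Q this
    exact ⟨N, hN, hNp, hNo.over.symm⟩
  obtain ⟨N₁, hN₁, hN₁p, hN₁b⟩ := gd Q₁ inferInstance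
  obtain ⟨N₂, hN₂, hN₂p, hN₂b⟩ := gd Q₂ inferInstance
  have hN : N₁ = N₂ := etale_normal_unique N₁ N₂ P₁ hN₁b hN₂b (hN₁.trans hP₁)
    (hN₂.trans (hP ▸ hP₂))
  have hNR : (N₁.comap (algebraMap C T)).comap (algebraMap R C) = RingHom.ker (algebraMap R L) := by
    rw [Ideal.comap_comap, ← hcomm', ← Ideal.comap_comap]
    have : N₁.comap (algebraMap (integralClosure R L) T) = ⊥ :=
      le_bot_iff.1 ((Ideal.comap_mono hN₁).trans hR₁.le)
    rw [this, ← RingHom.ker_eq_comap_bot]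
    ext r
    rw [RingHom.mem_ker, RingHom.mem_ker, ← Subtype.coe_inj]
    rfl
  rw [← hmin₁ _ (Ideal.IsPrime.comap _) (hQ₁ ▸ Ideal.comap_mono hN₁) hNR]
  exact hmin₂ _ (Ideal.IsPrime.comap _) (hQ₂ ▸ Ideal.comap_mono (hN ▸ hN₂)) hNR

theorem lift_algClosure {F Ω : Type*} [Field F] [Field Ω] [IsAlgClosed Ω] (m : F →+* Ω) :
    ∃ g : AlgebraicClosure F →+* Ω, ∀ x, g (algebraMap F _ x) = m x := by
  let _ : Algebra F Ω := m.toAlgebra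
  let g : AlgebraicClosure F →ₐ[F] Ω := IsAlgClosed.lift
  exact ⟨g.toRingHom, g.commutes⟩

theorem exists_geom_point {R C : Type u} [CommRing R] [CommRing C] [Algebra R C] (p : Ideal R)
    [p.IsPrime] (q : Ideal C) [q.IsPrime] (h : q.comap (algebraMap R C) = p) :
    ∃ (Ω : Type u) (_ : Field Ω) (g : AlgebraicClosure p.ResidueField →+* Ω) (φ : C →+* Ω),
      RingHom.ker φ = q ∧ ∀ r : R, g (algebraMap R _ r) = φ (algebraMap R C r) := by
  let Ω := AlgebraicClosure q.ResidueField
  let m : p.ResidueField →+* q.ResidueField := Ideal.ResidueField.map p q (algebraMap R C) h.symm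
  obtain ⟨g, hg⟩ := lift_algClosure ((algebraMap q.ResidueField Ω).comp m)
  refine ⟨Ω, inferInstance, g, (algebraMap q.ResidueField Ω).comp
    (algebraMap C q.ResidueField), ?_, ?_⟩
  · rw [RingHom.ker_comp_of_injective _ (algebraMap q.ResidueField Ω).injective]
    exact Ideal.ker_algebraMap_residueField q
  · intro r
    rw [IsScalarTower.algebraMap_apply R p.ResidueField (AlgebraicClosure p.ResidueField)]
    rw [hg]
    change algebraMap q.ResidueField Ω (m _) = algebraMap q.ResidueField Ω _
    congr 1
    exact Ideal.ResidueField.map_algebraMap p q (algebraMap R C) h.symm r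

open TensorProduct in
theorem main_mid {R A A' C : Type u} [CommRing R] [HenselianLocalRing R]
    [IsSepClosed (IsLocalRing.ResidueField R)] (p : Ideal R) [p.IsPrime]
    [CommRing A] [CommRing A'] [CommRing C] [IsDomain A'] [IsIntegrallyClosed A']
    [Algebra R A] [Algebra (integralClosure R (AlgebraicClosure p.ResidueField)) A'] [Algebra A A']
    [Algebra A C] [Algebra.Etale A C] [Algebra R C] [IsScalarTower R A C]
    (hcomm : ∀ r : R, algebraMap A A' (algebraMap R A r) =
      algebraMap (integralClosure R (AlgebraicClosure p.ResidueField)) A' (algebraMap R _ r))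
    (hadj : Algebra.adjoin A (Set.range
      (algebraMap (integralClosure R (AlgebraicClosure p.ResidueField)) A')) = ⊤)
    (hpush : ∀ (Ω : Type u) [Field Ω]
      (g : integralClosure R (AlgebraicClosure p.ResidueField) →+* Ω) (h : A →+* Ω),
      (∀ r : R, g (algebraMap R _ r) = h (algebraMap R A r)) →
      ∃ k : A' →+* Ω, (∀ y, k (algebraMap _ A' y) = g y) ∧ ∀ a, k (algebraMap A A' a) = h a)
    (q q₁ q₂ : Ideal C) [q.IsPrime] [q₁.IsPrime] [q₂.IsPrime] (h₁ : q₁ ≤ q) (h₂ : q₂ ≤ q)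
    (hqm : q.comap (algebraMap R C) = IsLocalRing.maximalIdeal R)
    (hp₁ : q₁.comap (algebraMap R C) = p) (hp₂ : q₂.comap (algebraMap R C) = p)
    (hmin₁ : ∀ q₀ : Ideal C, q₀.IsPrime → q₀ ≤ q₁ → q₀.comap (algebraMap R C) = p → q₀ = q₁)
    (hmin₂ : ∀ q₀ : Ideal C, q₀.IsPrime → q₀ ≤ q₂ → q₀.comap (algebraMap R C) = p → q₀ = q₂) :
    q₁ = q₂ := by
  let L := AlgebraicClosure p.ResidueField
  let R' := integralClosure R L
  let T := A' ⊗[A] C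
  let _ : Algebra C T := (Algebra.TensorProduct.includeRight : C →ₐ[A] T).toRingHom.toAlgebra
  let _ : Algebra R' T := ((algebraMap A' T).comp (algebraMap R' A')).toAlgebra
  have hker : RingHom.ker (algebraMap R L) = p := by
    rw [IsScalarTower.algebraMap_eq R p.ResidueField L,
      RingHom.ker_comp_of_injective _ (algebraMap p.ResidueField L).injective]
    exact Ideal.ker_algebraMap_residueField p
  have hAT : ∀ a : A, algebraMap A' T (algebraMap A A' a) = algebraMap C T (algebraMap A C a) := by
    intro a
    change (algebraMap A A' a) ⊗ₜ[A] (1 : C) = (1 : A') ⊗ₜ[A] algebraMap A C a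
    rw [Algebra.algebraMap_eq_smul_one, Algebra.algebraMap_eq_smul_one, TensorProduct.smul_tmul]
  have hcT : ∀ r : R, algebraMap R' T (algebraMap R _ r) = algebraMap C T (algebraMap R C r) := by
    intro r
    change algebraMap A' T (algebraMap R' A' (algebraMap R _ r)) = _
    rw [← hcomm, hAT]
    exact congrArg _ (IsScalarTower.algebraMap_apply R A C r).symm
  have hadjT : Algebra.adjoin C (Set.range (algebraMap R' T)) = ⊤ := by
    rw [eq_top_iff]
    have hA' : ∀ a : A', algebraMap A' T a ∈ Algebra.adjoin C (Set.range (algebraMap R' T)) := by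
      intro a
      have ha : a ∈ Algebra.adjoin A (Set.range (algebraMap R' A')) := by rw [hadj]; trivial
      induction ha using Algebra.adjoin_induction with
      | mem x hx =>
        obtain ⟨y, rfl⟩ := hx
        exact Algebra.subset_adjoin ⟨y, rfl⟩
      | algebraMap a => rw [hAT]; exact Subalgebra.algebraMap_mem _ _
      | add x y _ _ hx hy => rw [map_add]; exact add_mem hx hy
      | mul x y _ _ hx hy => rw [map_mul]; exact mul_mem hx hy
    intro z _
    induction z using TensorProduct.induction_on with
    | zero => exact zero_mem _
    | add x y hx hy => exact add_mem (hx trivial) (hy trivial)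
    | tmul a c =>
      have : a ⊗ₜ[A] c = algebraMap A' T a * algebraMap C T c := by
        change a ⊗ₜ[A] c = (a ⊗ₜ[A] (1 : C)) * ((1 : A') ⊗ₜ[A] c)
        simp
      rw [this]
      exact mul_mem (hA' a) (Subalgebra.algebraMap_mem _ _)
  have hpt : ∀ q₁ : Ideal C, q₁.IsPrime → q₁.comap (algebraMap R C) = p → ∃ Q : Ideal T, Q.IsPrime ∧
      Q.comap (algebraMap C T) = q₁ ∧ Q.comap (algebraMap R' T) = ⊥ := by
    intro q₁ _ hp₁
    obtain ⟨Ω, _, g, φ, hφ, hgφ⟩ := exists_geom_point p q₁ hp₁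
    obtain ⟨k, hk₁, hk₂⟩ := hpush Ω (g.comp (algebraMap R' L)) (φ.comp (algebraMap A C)) (by
      intro r
      have := hgφ r
      rw [IsScalarTower.algebraMap_apply R A C] at this
      exact this)
    let _ : Algebra A Ω := (φ.comp (algebraMap A C)).toAlgebra
    let k' : A' →ₐ[A] Ω := { k with commutes' := hk₂ }
    let φ' : C →ₐ[A] Ω := { φ with commutes' := fun _ => rfl }
    let Φ : T →ₐ[A] Ω := Algebra.TensorProduct.lift k' φ' (fun _ _ => Commute.all _ _)
    refine ⟨RingHom.ker Φ.toRingHom, RingHom.ker_isPrime _, ?_, ?_⟩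
    · rw [← hφ]
      ext c
      change Φ ((1 : A') ⊗ₜ[A] c) = 0 ↔ φ c = 0
      have : Φ ((1 : A') ⊗ₜ[A] c) = φ c := 
        (Algebra.TensorProduct.lift_tmul k' φ' (fun _ _ => Commute.all _ _) _ _).trans
          (by rw [map_one, one_mul]; rfl)
      rw [this]
    · ext y
      change Φ ((algebraMap R' A' y) ⊗ₜ[A] (1 : C)) = 0 ↔ y = 0
      have : Φ ((algebraMap R' A' y) ⊗ₜ[A] (1 : C)) = g (algebraMap R' L y) := 
        (Algebra.TensorProduct.lift_tmul k' φ' (fun _ _ => Commute.all _ _) _ _).trans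
          (by rw [map_one, mul_one]; exact hk₁ y)
      rw [this, map_eq_zero_iff _ g.injective, map_eq_zero_iff _ (FaithfulSMul.algebraMap_injective R' L)]
  obtain ⟨Q₁, _, hQ₁, hQR₁⟩ := hpt q₁ inferInstance hp₁
  obtain ⟨Q₂, _, hQ₂, hQR₂⟩ := hpt q₂ inferInstance hp₂
  exact main_abstract (R := R) (L := L) (A' := A') hcT hadjT q q₁ q₂ h₁ h₂ hqm Q₁ Q₂ hQ₁ hQ₂ hQR₁
    (by rwa [hker]) (by rwa [hker])

theorem std_normal (R' : Type u) [CommRing R'] [IsDomain R'] [IsIntegrallyClosed R'] (n l : ℕ)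
    (hln : l ≤ n) (b : R') (hb : b ≠ 0) (h0 : l = 0 → b = 1) :
    IsDomain (stdRing R' n l b) ∧ IsIntegrallyClosed (stdRing R' n l b) := by
  rcases Nat.eq_zero_or_pos l with hl | hl
  · have hI : Ideal.span {(∏ i : Fin n, if (i : ℕ) < l then MvPolynomial.X i else 1)
        - MvPolynomial.C b} = (⊥ : Ideal (MvPolynomial (Fin n) R')) := by
      rw [Ideal.span_singleton_eq_bot, h0 hl]
      simp [hl]
    let e : stdRing R' n l b ≃+* MvPolynomial (Fin n) R' :=
      (Ideal.quotEquivOfEq hI).trans (RingEquiv.quotientBot _)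
    have hd : IsDomain (stdRing R' n l b) := e.toMulEquiv.isDomain _
    have := mvPoly_isIntegrallyClosed (R := R') (Fin n)
    exact ⟨hd, IsIntegrallyClosed.of_equiv e.symm⟩
  · let J : Finset (Fin n) := Finset.univ.filter (fun i => (i : ℕ) < l)
    have hI : Ideal.span {(∏ i : Fin n, if (i : ℕ) < l then MvPolynomial.X i else 1)
        - MvPolynomial.C b} =
        Ideal.span {(∏ j ∈ J, MvPolynomial.X j : MvPolynomial (Fin n) R') - MvPolynomial.C b} := by
      rw [Finset.prod_filter]
    let e : stdRing R' n l b ≃+* GenStd J b := Ideal.quotEquivOfEq hI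
    have hi : (⟨0, by omega⟩ : Fin n) ∈ J := by simp [J, hl]
    have h1 : IsDomain (GenStd J b) := genStd_isDomain hb hi
    have hd : IsDomain (stdRing R' n l b) := e.toMulEquiv.isDomain _
    have := genStd_isIntegrallyClosed hi hb
    exact ⟨hd, IsIntegrallyClosed.of_equiv e.symm⟩

theorem std_adjoin_aux {R R' : Type u} [CommRing R] [CommRing R'] [Algebra R R'] (n l : ℕ) (b : R) :
    ∃ φ : stdRing R n l b →+* stdRing R' n l (algebraMap R R' b),
      (∀ P, φ (Ideal.Quotient.mk _ P) = Ideal.Quotient.mk _ (MvPolynomial.map (algebraMap R R') P)) := by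
  refine ⟨Ideal.quotientMap _ (MvPolynomial.map (algebraMap R R')) ?_, fun P => ?_⟩
  · rw [Ideal.span_le, Set.singleton_subset_iff]
    refine Ideal.subset_span ?_
    rw [Set.mem_singleton_iff, map_sub, map_prod, MvPolynomial.map_C]
    congr 1
    refine Finset.prod_congr rfl fun i _ => ?_
    split_ifs <;> simp
  · rw [Ideal.quotientMap_mk]

theorem main_alg {R C : Type u} [CommRing R] [HenselianLocalRing R]
    [IsSepClosed (IsLocalRing.ResidueField R)] (p : Ideal R) [p.IsPrime]
    (n l : ℕ) (hln : l ≤ n) (b : R) (hb : b ∉ p)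
    [CommRing C] [Algebra (stdRing R n l b) C] [Algebra.Etale (stdRing R n l b) C]
    [Algebra R C] [IsScalarTower R (stdRing R n l b) C]
    (q q₁ q₂ : Ideal C) [q.IsPrime] [q₁.IsPrime] [q₂.IsPrime] (h₁ : q₁ ≤ q) (h₂ : q₂ ≤ q)
    (hqm : q.comap (algebraMap R C) = IsLocalRing.maximalIdeal R)
    (hp₁ : q₁.comap (algebraMap R C) = p) (hp₂ : q₂.comap (algebraMap R C) = p)
    (hmin₁ : ∀ q₀ : Ideal C, q₀.IsPrime → q₀ ≤ q₁ → q₀.comap (algebraMap R C) = p → q₀ = q₁)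
    (hmin₂ : ∀ q₀ : Ideal C, q₀.IsPrime → q₀ ≤ q₂ → q₀.comap (algebraMap R C) = p → q₀ = q₂) :
    q₁ = q₂ := by
  let L := AlgebraicClosure p.ResidueField
  let R' := integralClosure R L
  have hker : RingHom.ker (algebraMap R L) = p := by
    rw [IsScalarTower.algebraMap_eq R p.ResidueField L,
      RingHom.ker_comp_of_injective _ (algebraMap p.ResidueField L).injective]
    exact Ideal.ker_algebraMap_residueField p
  have hR' : IsIntegrallyClosed R' := by
    refine isIntegrallyClosed_of_tower (A := R') (B := L) (FaithfulSMul.algebraMap_injective R' L) ?_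
    intro x hx
    exact ⟨⟨x, isIntegral_trans (R := R) (A := R') x hx⟩, rfl⟩
  have hmem : ∀ r : R, algebraMap R R' r = 0 ↔ r ∈ p := by
    intro r
    have h1 : r ∈ RingHom.ker (algebraMap R L) ↔ r ∈ p := by rw [hker]
    rw [← h1, RingHom.mem_ker, ← Subtype.coe_inj]
    rfl
  obtain ⟨hdom, hnorm⟩ := std_normal R' n l hln (algebraMap R R' b)
    (fun h => hb ((hmem b).1 h)) (by
      intro hl
      have h1 : algebraMap R (stdRing R n l b) (1 - b) = 0 := by
        change Ideal.Quotient.mk _ (MvPolynomial.C (1 - b)) = 0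
        rw [Ideal.Quotient.eq_zero_iff_mem]
        refine Ideal.subset_span ?_
        simp [hl]
      have h2 : (1 - b) ∈ q₁.comap (algebraMap R C) := by
        rw [Ideal.mem_comap, IsScalarTower.algebraMap_apply R (stdRing R n l b) C, h1, map_zero]
        exact zero_mem _
      rw [hp₁] at h2
      have := (hmem _).2 h2
      rw [map_sub, map_one, sub_eq_zero] at this
      exact this.symm)
  obtain ⟨φ, hφ⟩ := std_adjoin_aux (R := R) (R' := R') n l b
  let _ : Algebra (stdRing R n l b) (stdRing R' n l (algebraMap R R' b)) := φ.toAlgebra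
  refine main_mid (A := stdRing R n l b) (A' := stdRing R' n l (algebraMap R R' b)) p ?_ ?_ ?_
    q q₁ q₂ h₁ h₂ hqm hp₁ hp₂ hmin₁ hmin₂
  · intro r
    change φ (Ideal.Quotient.mk _ (MvPolynomial.C r)) = Ideal.Quotient.mk _ (MvPolynomial.C _)
    rw [hφ, MvPolynomial.map_C]
  · rw [eq_top_iff]
    intro z _
    obtain ⟨P, rfl⟩ := Ideal.Quotient.mk_surjective z
    induction P using MvPolynomial.induction_on with
    | C a => exact Algebra.subset_adjoin ⟨a, rfl⟩
    | add P Q hP hQ => rw [map_add]; exact add_mem (hP trivial) (hQ trivial)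
    | mul_X P i hP =>
      rw [map_mul]
      refine mul_mem (hP trivial) ?_
      have : Ideal.Quotient.mk _ (MvPolynomial.X i) =
          algebraMap (stdRing R n l b) (stdRing R' n l (algebraMap R R' b))
            (Ideal.Quotient.mk _ (MvPolynomial.X i)) := by
        change _ = φ _
        rw [hφ, MvPolynomial.map_X]
      rw [this]
      exact Subalgebra.algebraMap_mem _ _
  · intro Ω _ g h hgh
    let ev : MvPolynomial (Fin n) R' →+* Ω := MvPolynomial.eval₂Hom g
      (fun i => h (Ideal.Quotient.mk _ (MvPolynomial.X i)))
    have hev : ev.comp (MvPolynomial.map (algebraMap R R')) = h.comp (Ideal.Quotient.mk _) := by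
      refine MvPolynomial.ringHom_ext ?_ ?_
      · intro r
        simp only [ev, RingHom.comp_apply, MvPolynomial.map_C, MvPolynomial.coe_eval₂Hom,
          MvPolynomial.eval₂_C]
        exact hgh r
      · intro i
        simp [ev]
    have hk : ∀ a ∈ Ideal.span {(∏ i : Fin n, if (i : ℕ) < l then MvPolynomial.X i else 1)
        - MvPolynomial.C (algebraMap R R' b)}, ev a = 0 := by
      intro a ha
      rw [← RingHom.mem_ker]
      revert a
      rw [← SetLike.le_def, Ideal.span_le, Set.singleton_subset_iff]
      have h3 : (∏ i : Fin n, if (i : ℕ) < l then MvPolynomial.X i else 1)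
        - MvPolynomial.C (algebraMap R R' b) = MvPolynomial.map (algebraMap R R')
          ((∏ i : Fin n, if (i : ℕ) < l then MvPolynomial.X i else 1) - MvPolynomial.C b) := by
        rw [map_sub, map_prod, MvPolynomial.map_C]
        congr 1
        refine Finset.prod_congr rfl fun i _ => ?_
        split_ifs <;> simp
      rw [h3]
      change (ev.comp (MvPolynomial.map (algebraMap R R'))) _ = 0
      rw [hev, RingHom.comp_apply, Ideal.Quotient.eq_zero_iff_mem.2 (Ideal.mem_span_singleton_self _),
        map_zero]
    refine ⟨Ideal.Quotient.lift _ ev hk, ?_, ?_⟩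
    · intro y
      change Ideal.Quotient.lift _ ev hk (Ideal.Quotient.mk _ (MvPolynomial.C y)) = g y
      rw [Ideal.Quotient.lift_mk]
      simp [ev]
    · intro a
      obtain ⟨P, rfl⟩ := Ideal.Quotient.mk_surjective a
      change Ideal.Quotient.lift _ ev hk (φ _) = _
      rw [hφ, Ideal.Quotient.lift_mk]
      exact congrArg (fun f => f P) hev

section schemePart

theorem exists_minimal_over {R C : Type*} [CommRing R] [CommRing C] (ψ : R →+* C) (p : Ideal R)
    (u : Ideal C) [u.IsPrime] (hu : u.comap ψ = p) :
    ∃ v : Ideal C, v.IsPrime ∧ v ≤ u ∧ v.comap ψ = p ∧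
      ∀ q₀ : Ideal C, q₀.IsPrime → q₀ ≤ v → q₀.comap ψ = p → q₀ = v := by
  obtain ⟨v, hv, hvu⟩ := Ideal.exists_minimalPrimes_le (I := p.map ψ) (J := u)
    (Ideal.map_le_iff_le_comap.mpr hu.ge)
  refine ⟨v, hv.1.1, hvu, le_antisymm ((Ideal.comap_mono hvu).trans hu.le)
    (Ideal.map_le_iff_le_comap.mp hv.1.2), ?_⟩
  intro q₀ hq₀ hle hc
  exact le_antisymm hle (hv.2 ⟨hq₀, Ideal.map_le_iff_le_comap.mpr hc.ge⟩ hle)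

theorem fiberι_isEmbedding {X S : Scheme.{u}} (f : X ⟶ S) (s : S) :
    Topology.IsEmbedding (fiberι f s) :=
  (f.fiberι s).isEmbedding

theorem fiberι_range {X S : Scheme.{u}} (f : X ⟶ S) (s : S) :
    Set.range (fiberι f s) = f ⁻¹' {s} := f.range_fiberι s

theorem exists_lift_generic {R C : CommRingCat.{u}} {X : Scheme.{u}} (f : X ⟶ Spec R)
    (g : Spec C ⟶ X) [Flat g] (ψ : R ⟶ C) (hψ : g ≫ f = Spec.map ψ) (η : ↑(Spec R))
    (y : ↑(Spec C)) (Y : Set (fiberScheme f η))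
    (hY : Y ∈ irreducibleComponents ↑(fiberScheme f η))
    (hy : g y ∈ closure ((fiberι f η) '' Y)) :
    ∃ v : ↑(Spec C), v.asIdeal ≤ y.asIdeal ∧ v.asIdeal.comap ψ.hom = η.asIdeal ∧
      (∀ q₀ : Ideal C, q₀.IsPrime → q₀ ≤ v.asIdeal → q₀.comap ψ.hom = η.asIdeal →
        q₀ = v.asIdeal) ∧ closure ((fiberι f η) ⁻¹' {g v}) = Y := by
  have hYc : IsClosed Y := isClosed_of_mem_irreducibleComponents Y hY
  obtain ⟨ξ, hξ⟩ := QuasiSober.sober hY.1 hYc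
  have hfη : ∀ z : fiberScheme f η, f ((fiberι f η) z) = η := fun z => by
    have : (fiberι f η) z ∈ f ⁻¹' {η} := by rw [← fiberι_range]; exact ⟨z, rfl⟩
    exact this
  have hsp : (fiberι f η) ξ ⤳ g y := by
    rw [specializes_iff_mem_closure]
    refine closure_minimal ?_ isClosed_closure hy
    rintro _ ⟨z, hz, rfl⟩
    rw [← specializes_iff_mem_closure]
    have : ξ ⤳ z := by rw [specializes_iff_mem_closure, hξ.def]; exact hz
    exact this.map (fiberι f η).continuous
  obtain ⟨w, hw, hgw⟩ := Flat.generalizingMap g hsp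
  have hcomp : ∀ z : ↑(Spec C), (f (g z)).asIdeal = z.asIdeal.comap ψ.hom := fun z => by
    rw [← Scheme.Hom.comp_apply, hψ]; rfl
  haveI : w.asIdeal.IsPrime := PrimeSpectrum.isPrime w
  obtain ⟨v, hvp, hvw, hvc, hvmin⟩ := exists_minimal_over ψ.hom η.asIdeal w.asIdeal (by
    rw [← hcomp, hgw, hfη])
  let v' : ↑(Spec C) := ⟨v, hvp⟩
  have hv'w : v' ⤳ w := (PrimeSpectrum.le_iff_specializes v' w).mp hvw
  have hwy : w.asIdeal ≤ y.asIdeal := (PrimeSpectrum.le_iff_specializes w y).mpr hw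
  refine ⟨v', hvw.trans hwy, hvc, hvmin, ?_⟩
  have hgv : g v' ∈ Set.range (fiberι f η) := by
    rw [fiberι_range]
    apply PrimeSpectrum.ext
    rw [hcomp]; exact hvc
  obtain ⟨ζ, hζ⟩ := hgv
  have hζξ : ζ ⤳ ξ := by
    rw [← (fiberι_isEmbedding f η).isInducing.specializes_iff, hζ, ← hgw]
    exact hv'w.map g.continuous
  have h1 : (fiberι f η) ⁻¹' {g v'} = {ζ} := by
    ext z
    simp only [Set.mem_preimage, Set.mem_singleton_iff, ← hζ]
    exact (fiberι_isEmbedding f η).injective.eq_iff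
  rw [h1]
  have hle : Y ⊆ closure {ζ} := by
    rw [← hξ.def]; exact hζξ.closure_subset
  exact (hle.antisymm (hY.2 isIrreducible_singleton.closure hle)).symm

theorem final_aux (R : CommRingCat.{u})
    (hsh : StrictlyHenselianLocal ↥R)
    {X : Scheme.{u}} (f : X ⟶ Spec R)
    (η : ↑(Spec R)) (b : ↥R) (x : X) (hx : f x = closedPt R hsh.toIsLocalRing)
    (hb : HasLabel f x b)
    (hbunit : b ∉ η.asIdeal)
    (Y₁ : Set (fiberScheme f η)) (hY₁ : Y₁ ∈ irreducibleComponents ↑(fiberScheme f η))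
    (Y₂ : Set (fiberScheme f η)) (hY₂ : Y₂ ∈ irreducibleComponents ↑(fiberScheme f η))
    (h₁ : x ∈ closure ((fiberι f η) '' Y₁)) (h₂ : x ∈ closure ((fiberι f η) '' Y₂)) :
    Y₁ = Y₂ := by
  obtain ⟨n, l, hln, U, gX, x', gT, hgX, hgT, rfl, hcomm, -⟩ := hb
  obtain ⟨C, j, hj, y, hy⟩ : ∃ (C : CommRingCat.{u}) (j : Spec C ⟶ U) (_ : IsOpenImmersion j)
      (y : ↑(Spec C)), j y = x' := by
    obtain ⟨y, hy⟩ := U.affineOpenCover.covers x'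
    exact ⟨_, U.affineOpenCover.f _, U.affineOpenCover.map_prop _, y, hy⟩
  haveI : Etale gX := hgX
  haveI : Etale gT := hgT
  let A : CommRingCat.{u} := CommRingCat.of (stdRing ↥R n l b)
  let t : Spec C ⟶ Spec A := j ≫ gT
  haveI ht : Etale t := by
    letI : Etale (Y := stdScheme R n l b) (j ≫ gT) := inferInstance
    exact this
  let φ : A ⟶ C := Spec.preimage t
  have hφ : Spec.map φ = t := Spec.map_preimage t
  let α : R ⟶ A := CommRingCat.ofHom (algebraMap ↥R (stdRing ↥R n l b))
  have hψ : (j ≫ gX) ≫ f = Spec.map (α ≫ φ) := by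
    rw [Spec.map_comp, hφ, Category.assoc, ← hcomm]
    simp only [t, Category.assoc]; rfl
  have hφe : φ.hom.Etale := by
    rw [← hφ] at ht
    exact (HasRingHomProperty.Spec_iff (P := @Etale)).mp ht
  rw [← hy, ← Scheme.Hom.comp_apply] at h₁ h₂ hx
  obtain ⟨v₁, hv₁, hc₁, hm₁, he₁⟩ := exists_lift_generic f (j ≫ gX) _ hψ η y Y₁ hY₁ h₁
  obtain ⟨v₂, hv₂, hc₂, hm₂, he₂⟩ := exists_lift_generic f (j ≫ gX) _ hψ η y Y₂ hY₂ h₂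
  have hyc : y.asIdeal.comap (α ≫ φ).hom = @IsLocalRing.maximalIdeal ↥R _ hsh.toIsLocalRing := by
    rw [← Scheme.Hom.comp_apply, ← Category.assoc, hψ] at hx
    exact congrArg PrimeSpectrum.asIdeal hx
  letI : Algebra (stdRing ↥R n l b) C := φ.hom.toAlgebra
  letI : Algebra R C := (α ≫ φ).hom.toAlgebra
  haveI : Algebra.Etale (stdRing ↥R n l b) C := hφe
  haveI : IsScalarTower R (stdRing ↥R n l b) C :=
    @IsScalarTower.of_algebraMap_eq ↥R (stdRing ↥R n l b) C _ _ _ _ _ _ (fun _ => rfl)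
  haveI := hsh.henselian
  haveI : IsSepClosed (IsLocalRing.ResidueField R) := hsh.sepClosedResidue
  haveI : η.asIdeal.IsPrime := PrimeSpectrum.isPrime η
  haveI : y.asIdeal.IsPrime := PrimeSpectrum.isPrime y
  haveI : v₁.asIdeal.IsPrime := PrimeSpectrum.isPrime v₁
  haveI : v₂.asIdeal.IsPrime := PrimeSpectrum.isPrime v₂
  have := main_alg (R := R) (C := C) η.asIdeal n l hln b hbunit y.asIdeal v₁.asIdeal v₂.asIdeal
    hv₁ hv₂ hyc hc₁ hc₂ hm₁ hm₂
  rw [← he₁, ← he₂, PrimeSpectrum.ext this]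

end schemePart

/-- Lemma 3.6 of the paper.  Let `S = Spec R` with `R` a Noetherian
strictly henselian local ring with closed point `s`, `f : X ⟶ S` semistable and `η` a
generalisation of `s`.  If `X₁` and `X₂` are irreducible components of `X_s` which
intersect and contain a common element `Zs` of the `k`-strata of `X_s` (`k ≥ 1`) whose
label `(b)` is generated by an element `b` becoming a unit over `η`, then
`sp_{s→η}(X₁) = sp_{s→η}(X₂)`. -/
theorem sp_eq_of_common_stratum_unit_label
    (R : CommRingCat.{u}) (hNoeth : IsNoetherianRing ↥R)
    (hsh : StrictlyHenselianLocal ↥R)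
    {X : Scheme.{u}} (f : X ⟶ Spec R) (hss : IsSemistable f)
    (s : ↑(Spec R)) (hs : s = closedPt R hsh.toIsLocalRing)
    (η : ↑(Spec R)) (hgen : η ⤳ s)
    (X₁ X₂ : Set (fiberScheme f s))
    (hX₁ : X₁ ∈ irreducibleComponents ↑(fiberScheme f s))
    (hX₂ : X₂ ∈ irreducibleComponents ↑(fiberScheme f s))
    (hmeet : (X₁ ∩ X₂).Nonempty)
    (k : ℕ) (hk : 1 ≤ k) (Zs : Set (fiberScheme f s))
    (hZs : IsStratum (fiberRes f s) k Zs) (hZ₁ : Zs ⊆ X₁) (hZ₂ : Zs ⊆ X₂)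
    (b : ↥R) (hb : ∃ x ∈ Zs, HasLabel f ((fiberι f s).base x) b)
    (hbunit : b ∉ η.asIdeal) :
    ∀ Y₁ ∈ irreducibleComponents ↑(fiberScheme f η),
      ∀ Y₂ ∈ irreducibleComponents ↑(fiberScheme f η),
        spRel f s η X₁ Y₁ → spRel f s η X₂ Y₂ → Y₁ = Y₂ := by
  intro Y₁ hY₁ Y₂ hY₂ h₁ h₂
  obtain ⟨x, hxZ, hx⟩ := hb
  refine final_aux R hsh f η b ((fiberι f s) x) ?_ hx hbunit Y₁ hY₁ Y₂ hY₂
    (h₁ ⟨x, hZ₁ hxZ, rfl⟩) (h₂ ⟨x, hZ₂ hxZ, rfl⟩)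
  have : (fiberι f s) x ∈ f ⁻¹' {s} := by rw [← fiberι_range]; exact ⟨x, rfl⟩
  rw [← hs]; exact this


end NeronSemistable
end
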